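/- Moderate deviation converse for classical-quantum channel coding: Let W be a classical-quantum channel with finite input alphabet X and outputs density operators on ℂ^d, with minimal peripheral information variance V_W > 0, and let (a_n) be a sequence of reals with a_n → 0 and a_n·√n → +∞ as n → ∞. Then liminf_{n→∞} (1/(n·a_n²))·log ε*(n, C_W − a_n) ≥ −1/(2·V_W), where ε*(n,R) is the smallest average error probability among n-blocklength codes with ⌈exp(nR)⌉ messages. -/

import Mathlib

open scoped BigOperators ComplexOrder
open Filter

noncomputable section

namespace MDQ

/-- Functional calculus for Hermitian matrices (junk value `0` otherwise). -/
noncomputable def matFun {d : ℕ} (f : ℝ → ℝ) (A : Matrix (Fin d) (Fin d) ℂ) :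
    Matrix (Fin d) (Fin d) ℂ :=
  if hA : A.IsHermitian then hA.cfc f else 0

/-- Matrix logarithm on the support (`Real.log 0 = 0`). -/
noncomputable def mlog {d : ℕ} (A : Matrix (Fin d) (Fin d) ℂ) : Matrix (Fin d) (Fin d) ℂ :=
  matFun Real.log A

/-- Matrix real power, restricted to the support. -/
noncomputable def mpow {d : ℕ} (A : Matrix (Fin d) (Fin d) ℂ) (p : ℝ) :
    Matrix (Fin d) (Fin d) ℂ :=
  matFun (fun t => if t = 0 then 0 else t ^ p) A

/-- Matrix exponential via functional calculus. -/
noncomputable def mexp {d : ℕ} (A : Matrix (Fin d) (Fin d) ℂ) : Matrix (Fin d) (Fin d) ℂ :=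
  matFun Real.exp A

/-- Orthogonal projection onto the support of a Hermitian matrix. -/
noncomputable def suppProj {d : ℕ} (A : Matrix (Fin d) (Fin d) ℂ) : Matrix (Fin d) (Fin d) ℂ :=
  matFun (fun t => if t = 0 then 0 else 1) A

/-- `A` is a density operator. -/
def IsDensity {d : ℕ} (A : Matrix (Fin d) (Fin d) ℂ) : Prop :=
  A.PosSemidef ∧ A.trace = 1

/-- Real part of the trace. -/
noncomputable def reTr {ι : Type} [Fintype ι] (A : Matrix ι ι ℂ) : ℝ :=
  A.trace.re

/-- supp ρ ⊆ supp σ, phrased via ranges of the associated linear maps. -/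
def SuppLE {d : ℕ} (ρ σ : Matrix (Fin d) (Fin d) ℂ) : Prop :=
  LinearMap.range (Matrix.toLin' ρ) ≤ LinearMap.range (Matrix.toLin' σ)

/-- Quantum relative entropy `D(ρ‖σ)`. -/
noncomputable def qD {d : ℕ} (ρ σ : Matrix (Fin d) (Fin d) ℂ) : ℝ :=
  reTr (ρ * (mlog ρ - mlog σ))

/-- Quantum relative entropy variance `V(ρ‖σ)`. -/
noncomputable def qV {d : ℕ} (ρ σ : Matrix (Fin d) (Fin d) ℂ) : ℝ :=
  reTr (ρ * (mlog ρ - mlog σ) ^ 2) - (qD ρ σ) ^ 2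

/-- The variant relative entropy variance `Ṽ(ρ‖σ)`. -/
noncomputable def qVtilde {d : ℕ} (ρ σ : Matrix (Fin d) (Fin d) ℂ) : ℝ :=
  (∫ t in (0:ℝ)..1,
    reTr (mpow ρ (1 - t) * (mlog ρ - mlog σ) * mpow ρ t * (mlog ρ - mlog σ))) - (qD ρ σ) ^ 2

/-- The quantum Rényi divergence of order zero, `D₀(ρ‖σ) = -log Tr[Π_ρ σ]`. -/
noncomputable def qD0 {d : ℕ} (ρ σ : Matrix (Fin d) (Fin d) ℂ) : ℝ :=
  - Real.log (reTr (suppProj ρ * σ))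

/-- Tensor product of a finite family of `d × d` matrices. -/
noncomputable def tensorSeq {d n : ℕ} (A : Fin n → Matrix (Fin d) (Fin d) ℂ) :
    Matrix (Fin n → Fin d) (Fin n → Fin d) ℂ :=
  Matrix.of fun i j => ∏ k, A k (i k) (j k)

/-- `n`-fold tensor power of a matrix. -/
noncomputable def tensorPow {d : ℕ} (A : Matrix (Fin d) (Fin d) ℂ) (n : ℕ) :
    Matrix (Fin n → Fin d) (Fin n → Fin d) ℂ :=
  tensorSeq (fun _ => A)

/-- Smallest type-I error with type-II error at most `μ`:  `α̂_μ(ρ‖σ)`. -/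
noncomputable def hypoErr {ι : Type} [Fintype ι] [DecidableEq ι]
    (ρ σ : Matrix ι ι ℂ) (μ : ℝ) : ℝ :=
  sInf { a : ℝ | ∃ Q : Matrix ι ι ℂ, Q.PosSemidef ∧ (1 - Q).PosSemidef ∧
    reTr (Q * σ) ≤ μ ∧ a = reTr ((1 - Q) * ρ) }

/-- `P` is a probability distribution on a finite alphabet. -/
def IsProbDist {X : Type} [Fintype X] (P : X → ℝ) : Prop :=
  (∀ x, 0 ≤ P x) ∧ ∑ x, P x = 1

/-- The average output state `PW`. -/
noncomputable def avgState {X : Type} [Fintype X] {d : ℕ}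
    (P : X → ℝ) (W : X → Matrix (Fin d) (Fin d) ℂ) : Matrix (Fin d) (Fin d) ℂ :=
  ∑ x, (P x : ℂ) • W x

/-- Mutual information `I(P, W)`. -/
noncomputable def mutualInfo {X : Type} [Fintype X] {d : ℕ}
    (P : X → ℝ) (W : X → Matrix (Fin d) (Fin d) ℂ) : ℝ :=
  ∑ x, P x * qD (W x) (avgState P W)

/-- Capacity `C_W`. -/
noncomputable def capacity {X : Type} [Fintype X] {d : ℕ}
    (W : X → Matrix (Fin d) (Fin d) ℂ) : ℝ :=
  sSup { c : ℝ | ∃ P : X → ℝ, IsProbDist P ∧ c = mutualInfo P W }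

/-- Conditional information variance `V(P, W)`. -/
noncomputable def infoVar {X : Type} [Fintype X] {d : ℕ}
    (P : X → ℝ) (W : X → Matrix (Fin d) (Fin d) ℂ) : ℝ :=
  ∑ x, P x * qV (W x) (avgState P W)

/-- The variant conditional information variance `Ṽ(P, W)`. -/
noncomputable def infoVarTilde {X : Type} [Fintype X] {d : ℕ}
    (P : X → ℝ) (W : X → Matrix (Fin d) (Fin d) ℂ) : ℝ :=
  ∑ x, P x * qVtilde (W x) (avgState P W)

/-- Minimal peripheral information variance `V_W`. -/
noncomputable def Vmin {X : Type} [Fintype X] {d : ℕ}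
    (W : X → Matrix (Fin d) (Fin d) ℂ) : ℝ :=
  sInf { v : ℝ | ∃ P : X → ℝ, IsProbDist P ∧ mutualInfo P W = capacity W ∧ v = infoVar P W }

/-- Minimal variant peripheral information variance `Ṽ_W`. -/
noncomputable def VminTilde {X : Type} [Fintype X] {d : ℕ}
    (W : X → Matrix (Fin d) (Fin d) ℂ) : ℝ :=
  sInf { v : ℝ | ∃ P : X → ℝ, IsProbDist P ∧ mutualInfo P W = capacity W ∧ v = infoVarTilde P W }

/-- Conditional relative entropy `D(W‖σ|P)`. -/
noncomputable def Dcond {X : Type} [Fintype X] {d : ℕ}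
    (W : X → Matrix (Fin d) (Fin d) ℂ) (σ : Matrix (Fin d) (Fin d) ℂ) (P : X → ℝ) : ℝ :=
  ∑ x, P x * qD (W x) σ

/-- Conditional relative entropy variance `V(W‖σ|P)`. -/
noncomputable def Vcond {X : Type} [Fintype X] {d : ℕ}
    (W : X → Matrix (Fin d) (Fin d) ℂ) (σ : Matrix (Fin d) (Fin d) ℂ) (P : X → ℝ) : ℝ :=
  ∑ x, P x * qV (W x) σ

/-- Conditional order-zero Rényi divergence `D₀(W‖σ|P)`. -/
noncomputable def D0cond {X : Type} [Fintype X] {d : ℕ}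
    (W : X → Matrix (Fin d) (Fin d) ℂ) (σ : Matrix (Fin d) (Fin d) ℂ) (P : X → ℝ) : ℝ :=
  ∑ x, P x * qD0 (W x) σ

/-- The exponent function `E_h(s, P, σ)`. -/
noncomputable def Eh {X : Type} [Fintype X] {d : ℕ}
    (W : X → Matrix (Fin d) (Fin d) ℂ) (s : ℝ) (P : X → ℝ)
    (σ : Matrix (Fin d) (Fin d) ℂ) : ℝ :=
  -(1 + s) * ∑ x, P x * Real.log (reTr (mpow (W x) (1 / (1 + s)) * mpow σ (s / (1 + s))))

/-- The log-Euclidean exponent function `Ẽ_h(s, P, σ)`. -/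
noncomputable def EhTilde {X : Type} [Fintype X] {d : ℕ}
    (W : X → Matrix (Fin d) (Fin d) ℂ) (s : ℝ) (P : X → ℝ)
    (σ : Matrix (Fin d) (Fin d) ℂ) : ℝ :=
  -(1 + s) * ∑ x, P x *
    Real.log (reTr (mexp ((((1 + s)⁻¹ : ℝ) : ℂ) • (mlog (W x) + ((s : ℝ) : ℂ) • mlog σ))))

/-- The modified auxiliary function `Ẽ₀(s, P, σ)`. -/
noncomputable def E0Tilde {X : Type} [Fintype X] {d : ℕ}
    (W : X → Matrix (Fin d) (Fin d) ℂ) (s : ℝ) (P : X → ℝ)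
    (σ : Matrix (Fin d) (Fin d) ℂ) : ℝ :=
  - Real.log (∑ x, P x * reTr (mpow (W x) (1 - s) * mpow σ s))

/-- The sphere-packing exponent `E_sp^{(2)}(R, P, σ)`. -/
noncomputable def Esp2 {X : Type} [Fintype X] {d : ℕ}
    (W : X → Matrix (Fin d) (Fin d) ℂ) (R : ℝ) (P : X → ℝ)
    (σ : Matrix (Fin d) (Fin d) ℂ) : ℝ :=
  sSup { e : ℝ | ∃ s : ℝ, 0 ≤ s ∧ e = Eh W s P σ - s * R }

/-- The sphere-packing exponent `Ẽ_sp(R, P, σ)`. -/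
noncomputable def EspTilde {X : Type} [Fintype X] {d : ℕ}
    (W : X → Matrix (Fin d) (Fin d) ℂ) (R : ℝ) (P : X → ℝ)
    (σ : Matrix (Fin d) (Fin d) ℂ) : ℝ :=
  sSup { e : ℝ | ∃ s : ℝ, 0 ≤ s ∧ e = EhTilde W s P σ - s * R }

open Classical in
/-- Empirical distribution of a word `x^n ∈ X^n`. -/
noncomputable def empDist {X : Type} [Fintype X] {n : ℕ} (xs : Fin n → X) (x : X) : ℝ :=
  ((Finset.univ.filter fun i => xs i = x).card : ℝ) / n

/-- Smallest average error probability `ε*(n, R)` over all `n`-blocklength codes with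
`⌈exp (n R)⌉` messages. -/
noncomputable def optErr {X : Type} [Fintype X] {d : ℕ}
    (W : X → Matrix (Fin d) (Fin d) ℂ) (n : ℕ) (R : ℝ) : ℝ :=
  sInf { e : ℝ | ∃ (f : Fin ⌈Real.exp (n * R)⌉₊ → Fin n → X)
    (Pov : Fin ⌈Real.exp (n * R)⌉₊ → Matrix (Fin n → Fin d) (Fin n → Fin d) ℂ),
    (∀ m, (Pov m).PosSemidef) ∧ (∑ m, Pov m) = 1 ∧
    e = (1 / (⌈Real.exp (n * R)⌉₊ : ℝ)) *
      ∑ m, (1 - reTr (Pov m * tensorSeq (fun k => W (f m k)))) }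

/-- The binary entropy function. -/
noncomputable def binEnt (p : ℝ) : ℝ :=
  -p * Real.log p - (1 - p) * Real.log (1 - p)

open Matrix in
/-- Squared moduli of the inner products between the columns of `U` and those of `V`. -/
def overlap {ι : Type} [Fintype ι] (U V : Matrix ι ι ℂ) (i j : ι) : ℝ :=
  Complex.normSq ((Uᴴ * V) i j)

lemma overlap_nonneg {ι : Type} [Fintype ι] (U V : Matrix ι ι ℂ) (i j : ι) :
    0 ≤ overlap U V i j := Complex.normSq_nonneg _

open Matrix in
lemma overlap_comm {ι : Type} [Fintype ι] (U V : Matrix ι ι ℂ) (i j : ι) : overlap U V i j = overlap V U j i := by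
  unfold overlap
  have : Vᴴ * U = (Uᴴ * V)ᴴ := by simp
  rw [this, conjTranspose_apply, Complex.star_def, Complex.normSq_conj]

section Spectral
open Matrix

variable {ι : Type} [Fintype ι] [DecidableEq ι]

lemma reTr_mul_diagonal_mul_diagonal (T : Matrix ι ι ℂ) (a b : ι → ℝ) :
    reTr (diagonal (fun i => (a i : ℂ)) * T * diagonal (fun j => (b j : ℂ)) * Tᴴ) =
      ∑ i, ∑ j, a i * b j * Complex.normSq (T i j) := by
  unfold reTr
  rw [Matrix.trace, Complex.re_sum]
  refine Finset.sum_congr rfl fun i _ => ?_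
  rw [Matrix.diag_apply, Matrix.mul_apply, Complex.re_sum]
  refine Finset.sum_congr rfl fun j _ => ?_
  rw [Matrix.mul_diagonal, Matrix.diagonal_mul, Matrix.conjTranspose_apply]
  have : (a i : ℂ) * T i j * (b j : ℂ) * star (T i j) =
      ((a i * b j * Complex.normSq (T i j) : ℝ) : ℂ) := by
    have h := Complex.mul_conj (T i j)
    push_cast
    rw [← h]
    simp only [Complex.star_def]
    ring
  rw [this, Complex.ofReal_re]

lemma reTr_conj_mul_conj (U V : Matrix ι ι ℂ) (a b : ι → ℝ) :
    reTr ((U * diagonal (fun i => (a i : ℂ)) * Uᴴ) * (V * diagonal (fun j => (b j : ℂ)) * Vᴴ)) =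
      ∑ i, ∑ j, a i * b j * overlap U V i j := by
  unfold overlap
  rw [← reTr_mul_diagonal_mul_diagonal]
  unfold reTr
  rw [show (U * diagonal (fun i => (a i : ℂ)) * Uᴴ) * (V * diagonal (fun j => (b j : ℂ)) * Vᴴ) =
    U * (diagonal (fun i => (a i : ℂ)) * (Uᴴ * V) * diagonal (fun j => (b j : ℂ)) * Vᴴ) by
      simp only [Matrix.mul_assoc], Matrix.trace_mul_comm]
  simp only [Matrix.conjTranspose_mul, Matrix.conjTranspose_conjTranspose, Matrix.mul_assoc]

lemma sum_overlap_right {U V : Matrix ι ι ℂ} (hU : Uᴴ * U = 1) (hV : V * Vᴴ = 1) (i : ι) :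
    ∑ j, overlap U V i j = 1 := by
  have h : (Uᴴ * V) * (Uᴴ * V)ᴴ = 1 := by
    rw [conjTranspose_mul, conjTranspose_conjTranspose, Matrix.mul_assoc, ← Matrix.mul_assoc V,
      hV, Matrix.one_mul, hU]
  have h2 := congrFun (congrFun h i) i
  rw [Matrix.mul_apply, one_apply_eq] at h2
  have h3 : ((∑ j, overlap U V i j : ℝ) : ℂ) = 1 := by
    rw [← h2]
    push_cast
    refine Finset.sum_congr rfl fun j _ => ?_
    rw [conjTranspose_apply, overlap, Complex.star_def, Complex.mul_conj]
  exact_mod_cast h3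

lemma sum_overlap_left {U V : Matrix ι ι ℂ} (hU : U * Uᴴ = 1) (hV : Vᴴ * V = 1) (j : ι) :
    ∑ i, overlap U V i j = 1 := by
  simp_rw [overlap_comm U V]
  exact sum_overlap_right hV hU j

open scoped MatrixOrder Matrix.Norms.L2Operator in
lemma exists_eq_conjTranspose_mul_self {A : Matrix ι ι ℂ} (hA : A.PosSemidef) :
    ∃ C : Matrix ι ι ℂ, A = Cᴴ * C :=
  CStarAlgebra.nonneg_iff_eq_star_mul_self.1 hA.nonneg

lemma reTr_mul_nonneg {A B : Matrix ι ι ℂ} (hA : A.PosSemidef) (hB : B.PosSemidef) :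
    0 ≤ reTr (A * B) := by
  obtain ⟨C, rfl⟩ := exists_eq_conjTranspose_mul_self hA
  unfold reTr
  rw [Matrix.mul_assoc, Matrix.trace_mul_comm]
  exact (Complex.nonneg_iff.1 (hB.mul_mul_conjTranspose_same C).trace_nonneg).1

lemma posSemidef_sub_mul_self {Q : Matrix ι ι ℂ} (hQ : Q.PosSemidef) (hQ1 : (1 - Q).PosSemidef) :
    (Q - Q * Q).PosSemidef := by
  have h1 := hQ1.mul_mul_conjTranspose_same Q
  have h2 := hQ.mul_mul_conjTranspose_same (1 - Q)
  rw [hQ.1.eq] at h1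
  rw [hQ1.1.eq] at h2
  have := h1.add h2
  convert this using 1
  noncomm_ring

/-- A test between two diagonalized positive operators errs at least as much as half of the
optimal classical test between the associated Nussbaum–Szkoła weights. -/
lemma half_sum_min_le {U V Q : Matrix ι ι ℂ} (hU : U * Uᴴ = 1) (hV : V * Vᴴ = 1)
    {a b : ι → ℝ} (ha : ∀ i, 0 ≤ a i) (hb : ∀ i, 0 ≤ b i)
    (hQ : Q.PosSemidef) (hQ1 : (1 - Q).PosSemidef) :
    1 / 2 * ∑ i, ∑ j, min (a i) (b j) * overlap U V i j ≤
      reTr ((1 - Q) * (U * diagonal (fun i => (a i : ℂ)) * Uᴴ)) +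
        reTr (Q * (V * diagonal (fun j => (b j : ℂ)) * Vᴴ)) := by
  have psd : ∀ {a : ι → ℝ} (U : Matrix ι ι ℂ), (∀ i, 0 ≤ a i) →
      (U * diagonal (fun i => (a i : ℂ)) * Uᴴ).PosSemidef := by
    intro a U ha
    refine PosSemidef.mul_mul_conjTranspose_same ?_ U
    refine posSemidef_diagonal_iff.2 fun i => ?_
    exact Complex.zero_le_real.2 (ha i)
  have key : ∀ {Q U V : Matrix ι ι ℂ} {b : ι → ℝ}, U * Uᴴ = 1 → (∀ i, 0 ≤ b i) →
      Q.PosSemidef → (1 - Q).PosSemidef →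
      ∑ i, ∑ j, b j * Complex.normSq ((Uᴴ * Q * V) i j) ≤
        reTr (Q * (V * diagonal (fun j => (b j : ℂ)) * Vᴴ)) := by
    intro Q U V b hU hb hQ hQ1
    have h1 := reTr_mul_nonneg (posSemidef_sub_mul_self hQ hQ1) (psd V hb)
    have h2 : reTr (Q * Q * (V * diagonal (fun j => (b j : ℂ)) * Vᴴ)) =
        ∑ i, ∑ j, b j * Complex.normSq ((Uᴴ * Q * V) i j) := by
      have := reTr_mul_diagonal_mul_diagonal (Uᴴ * Q * V) 1 b
      simp only [Pi.one_apply, one_mul, Complex.ofReal_one, diagonal_one] at this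
      rw [← this]
      unfold reTr
      rw [conjTranspose_mul, conjTranspose_mul, conjTranspose_conjTranspose, hQ.1.eq,
        show Uᴴ * Q * V * diagonal (fun j => (b j : ℂ)) * (Vᴴ * (Q * U)) =
          (Uᴴ * (Q * V * diagonal (fun j => (b j : ℂ)) * Vᴴ * Q)) * U by
          simp only [Matrix.mul_assoc], Matrix.trace_mul_comm _ U, ← Matrix.mul_assoc U, hU,
        Matrix.one_mul, Matrix.trace_mul_comm _ Q]
      simp only [Matrix.mul_assoc]
    rw [Matrix.sub_mul] at h1
    unfold reTr at h1 h2 ⊢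
    rw [Matrix.trace_sub, Complex.sub_re, h2] at h1
    linarith
  have k1 := key (Q := Q) (V := V) hU hb hQ hQ1
  have k2 := key (Q := 1 - Q) (V := U) hV ha hQ1 (by simpa using hQ)
  refine le_trans ?_ (add_le_add k2 k1)
  rw [Finset.sum_comm (f := fun i j => a j * _), ← Finset.sum_add_distrib, Finset.mul_sum]
  refine Finset.sum_le_sum fun i _ => ?_
  rw [← Finset.sum_add_distrib, Finset.mul_sum]
  refine Finset.sum_le_sum fun j _ => ?_
  have e : (Vᴴ * (1 - Q) * U) j i = star ((Uᴴ * (1 - Q) * V) i j) := by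
    rw [← conjTranspose_apply]
    simp only [conjTranspose_mul, conjTranspose_conjTranspose, hQ1.1.eq, Matrix.mul_assoc]
  have e2 : (Uᴴ * V) i j = (Uᴴ * (1 - Q) * V) i j + (Uᴴ * Q * V) i j := by
    rw [← Matrix.add_apply]
    rw [← Matrix.add_mul, ← Matrix.mul_add, sub_add_cancel, Matrix.mul_one]
  rw [e, Complex.star_def, Complex.normSq_conj, overlap, e2]
  set x := (Uᴴ * (1 - Q) * V) i j
  set y := (Uᴴ * Q * V) i j
  have h3 : Complex.normSq (x + y) ≤ 2 * (Complex.normSq x + Complex.normSq y) := by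
    simp only [Complex.normSq_apply, Complex.add_re, Complex.add_im]
    nlinarith [sq_nonneg (x.re - y.re), sq_nonneg (x.im - y.im)]
  have hm : 0 ≤ min (a i) (b j) := le_min (ha i) (hb j)
  have h4 := mul_le_mul_of_nonneg_left h3 hm
  have h5 := mul_le_mul_of_nonneg_right (min_le_left (a i) (b j)) (Complex.normSq_nonneg x)
  have h6 := mul_le_mul_of_nonneg_right (min_le_right (a i) (b j)) (Complex.normSq_nonneg y)
  linarith

end Spectral

section NussbaumSzkola
open Matrix

variable {d : ℕ}

/-- A unitary matrix diagonalizing the Hermitian matrix `A`. -/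
def eigU (A : Matrix (Fin d) (Fin d) ℂ) : Matrix (Fin d) (Fin d) ℂ :=
  if h : A.IsHermitian then (h.eigenvectorUnitary : Matrix (Fin d) (Fin d) ℂ) else 1

/-- The eigenvalues of the Hermitian matrix `A`. -/
def eigV (A : Matrix (Fin d) (Fin d) ℂ) : Fin d → ℝ :=
  if h : A.IsHermitian then h.eigenvalues else 0

lemma eigU_mul_conjTranspose (A : Matrix (Fin d) (Fin d) ℂ) : eigU A * (eigU A)ᴴ = 1 := by
  unfold eigU
  split_ifs with h
  · exact Unitary.coe_mul_star_self h.eigenvectorUnitary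
  · simp

lemma conjTranspose_mul_eigU (A : Matrix (Fin d) (Fin d) ℂ) : (eigU A)ᴴ * eigU A = 1 := by
  unfold eigU
  split_ifs with h
  · exact Unitary.coe_star_mul_self h.eigenvectorUnitary
  · simp

lemma matFun_eq {A : Matrix (Fin d) (Fin d) ℂ} (hA : A.IsHermitian) (f : ℝ → ℝ) :
    matFun f A = eigU A * diagonal (fun i => (f (eigV A i) : ℂ)) * (eigU A)ᴴ := by
  unfold matFun eigU eigV
  simp only [dif_pos hA]
  rfl

lemma eq_eig {A : Matrix (Fin d) (Fin d) ℂ} (hA : A.IsHermitian) :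
    A = eigU A * diagonal (fun i => (eigV A i : ℂ)) * (eigU A)ᴴ := by
  unfold eigU eigV
  simp only [dif_pos hA]
  exact hA.spectral_theorem

lemma matFun_id {A : Matrix (Fin d) (Fin d) ℂ} (hA : A.IsHermitian) : matFun (fun t => t) A = A := by
  rw [matFun_eq hA, ← eq_eig hA]

lemma matFun_mul {A : Matrix (Fin d) (Fin d) ℂ} (hA : A.IsHermitian) (f g : ℝ → ℝ) :
    matFun f A * matFun g A = matFun (fun t => f t * g t) A := by
  rw [matFun_eq hA, matFun_eq hA, matFun_eq hA]
  rw [show ∀ D E : Matrix (Fin d) (Fin d) ℂ, eigU A * D * (eigU A)ᴴ * (eigU A * E * (eigU A)ᴴ) =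
    eigU A * D * ((eigU A)ᴴ * eigU A) * E * (eigU A)ᴴ by intros; simp only [Matrix.mul_assoc],
    conjTranspose_mul_eigU, Matrix.mul_one, Matrix.mul_assoc (eigU A), diagonal_mul_diagonal]
  simp

lemma eigV_nonneg {A : Matrix (Fin d) (Fin d) ℂ} (hA : A.PosSemidef) (i : Fin d) :
    0 ≤ eigV A i := by
  unfold eigV
  rw [dif_pos hA.1]
  exact hA.eigenvalues_nonneg i

lemma reTr_matFun {A : Matrix (Fin d) (Fin d) ℂ} (hA : A.IsHermitian) (f : ℝ → ℝ) :
    reTr (matFun f A) = ∑ i, f (eigV A i) := by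
  rw [matFun_eq hA]
  unfold reTr
  rw [Matrix.trace_mul_comm, ← Matrix.mul_assoc, conjTranspose_mul_eigU, Matrix.one_mul,
    trace_diagonal]
  simp

lemma reTr_eq_one {A : Matrix (Fin d) (Fin d) ℂ} (hA : IsDensity A) : reTr A = 1 := by
  unfold reTr
  rw [hA.2, Complex.one_re]

lemma sum_eigV {A : Matrix (Fin d) (Fin d) ℂ} (hA : IsDensity A) : ∑ i, eigV A i = 1 := by
  rw [← reTr_eq_one hA, ← matFun_id hA.1.1, reTr_matFun hA.1.1, matFun_id hA.1.1]

lemma eigV_le_one {A : Matrix (Fin d) (Fin d) ℂ} (hA : IsDensity A) (i : Fin d) :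
    eigV A i ≤ 1 := by
  rw [← sum_eigV hA]
  exact Finset.single_le_sum (fun j _ => eigV_nonneg hA.1 j) (Finset.mem_univ i)

/-- First Nussbaum–Szkoła distribution of a pair of states. -/
def jointP (ρ σ : Matrix (Fin d) (Fin d) ℂ) (z : Fin d × Fin d) : ℝ :=
  eigV ρ z.1 * overlap (eigU ρ) (eigU σ) z.1 z.2

/-- Second Nussbaum–Szkoła distribution of a pair of states. -/
def jointQ (ρ σ : Matrix (Fin d) (Fin d) ℂ) (z : Fin d × Fin d) : ℝ :=
  eigV σ z.2 * overlap (eigU ρ) (eigU σ) z.1 z.2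

/-- Log-likelihood ratio of the two Nussbaum–Szkoła distributions. -/
def logRatio (ρ σ : Matrix (Fin d) (Fin d) ℂ) (z : Fin d × Fin d) : ℝ :=
  Real.log (eigV ρ z.1) - Real.log (eigV σ z.2)

/-- The kernel of `σ` carries no weight of `ρ`. -/
def AbsCont (ρ σ : Matrix (Fin d) (Fin d) ℂ) : Prop :=
  ∀ z, eigV σ z.2 = 0 → jointP ρ σ z = 0

variable {ρ σ : Matrix (Fin d) (Fin d) ℂ}

lemma jointP_nonneg (hρ : ρ.PosSemidef) (z : Fin d × Fin d) : 0 ≤ jointP ρ σ z :=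
  mul_nonneg (eigV_nonneg hρ _) (overlap_nonneg _ _ _ _)

lemma jointQ_nonneg (hσ : σ.PosSemidef) (z : Fin d × Fin d) : 0 ≤ jointQ ρ σ z :=
  mul_nonneg (eigV_nonneg hσ _) (overlap_nonneg _ _ _ _)

lemma sum_jointP (hρ : IsDensity ρ) : ∑ z, jointP ρ σ z = 1 := by
  rw [Fintype.sum_prod_type, ← sum_eigV hρ]
  refine Finset.sum_congr rfl fun i _ => ?_
  simp only [jointP]
  rw [← Finset.mul_sum, sum_overlap_right (conjTranspose_mul_eigU ρ) (eigU_mul_conjTranspose σ),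
    mul_one]

lemma sum_jointQ (hσ : IsDensity σ) : ∑ z, jointQ ρ σ z = 1 := by
  rw [Fintype.sum_prod_type_right, ← sum_eigV hσ]
  refine Finset.sum_congr rfl fun i _ => ?_
  simp only [jointQ]
  rw [← Finset.mul_sum, sum_overlap_left (eigU_mul_conjTranspose ρ) (conjTranspose_mul_eigU σ),
    mul_one]

lemma reTr_matFun_mul_matFun (hρ : ρ.IsHermitian) (hσ : σ.IsHermitian) (f g : ℝ → ℝ) :
    reTr (matFun f ρ * matFun g σ) =
      ∑ z : Fin d × Fin d, f (eigV ρ z.1) * g (eigV σ z.2) *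
        overlap (eigU ρ) (eigU σ) z.1 z.2 := by
  rw [matFun_eq hρ, matFun_eq hσ, reTr_conj_mul_conj, Fintype.sum_prod_type]

lemma reTr_mul_matFun (hρ : ρ.IsHermitian) (hσ : σ.IsHermitian) (g : ℝ → ℝ) :
    reTr (ρ * matFun g σ) = ∑ z, jointP ρ σ z * g (eigV σ z.2) := by
  conv_lhs => rw [← matFun_id hρ]
  rw [reTr_matFun_mul_matFun hρ hσ]
  refine Finset.sum_congr rfl fun z _ => ?_
  unfold jointP
  ring

lemma reTr_matFun_eq_sum (hρ : ρ.IsHermitian) (hσ : σ.IsHermitian) (f : ℝ → ℝ) :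
    reTr (matFun f ρ) =
      ∑ z : Fin d × Fin d, f (eigV ρ z.1) * overlap (eigU ρ) (eigU σ) z.1 z.2 := by
  have h := reTr_matFun_mul_matFun hρ hσ f (fun _ => 1)
  have h1 : matFun (fun _ => 1) σ = 1 := by
    rw [matFun_eq hσ]
    simp [eigU_mul_conjTranspose]
  rw [h1, Matrix.mul_one] at h
  simpa using h

lemma reTr_add {ι : Type} [Fintype ι] (A B : Matrix ι ι ℂ) : reTr (A + B) = reTr A + reTr B := by
  simp [reTr]

lemma reTr_sub {ι : Type} [Fintype ι] (A B : Matrix ι ι ℂ) : reTr (A - B) = reTr A - reTr B := by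
  simp [reTr]

lemma reTr_sum {ι κ : Type} [Fintype ι] (s : Finset κ) (A : κ → Matrix ι ι ℂ) :
    reTr (∑ k ∈ s, A k) = ∑ k ∈ s, reTr (A k) := by
  simp [reTr, Matrix.trace_sum]

lemma reTr_smul {ι : Type} [Fintype ι] (c : ℝ) (A : Matrix ι ι ℂ) :
    reTr ((c : ℂ) • A) = c * reTr A := by
  simp [reTr]

lemma qD_eq_sum (hρ : ρ.IsHermitian) (hσ : σ.IsHermitian) :
    qD ρ σ = ∑ z, jointP ρ σ z * logRatio ρ σ z := by
  unfold qD mlog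
  rw [Matrix.mul_sub, reTr_sub, reTr_mul_matFun hρ hσ]
  conv_lhs => enter [1, 1, 1]; rw [← matFun_id hρ]
  rw [matFun_mul hρ, reTr_matFun_eq_sum hρ hσ, ← Finset.sum_sub_distrib]
  refine Finset.sum_congr rfl fun z _ => ?_
  unfold jointP logRatio
  ring

lemma qV_eq_sum (hρ : ρ.IsHermitian) (hσ : σ.IsHermitian) :
    qV ρ σ = ∑ z, jointP ρ σ z * logRatio ρ σ z ^ 2 - qD ρ σ ^ 2 := by
  unfold qV
  congr 1
  have e : reTr (ρ * (mlog ρ - mlog σ) ^ 2) =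
      reTr (matFun (fun t => t * Real.log t * Real.log t) ρ)
      - reTr (matFun (fun t => t * Real.log t) ρ * matFun Real.log σ)
      - reTr (matFun (fun t => Real.log t * t) ρ * matFun Real.log σ)
      + reTr (ρ * matFun (fun t => Real.log t * Real.log t) σ) := by
    rw [← matFun_mul hρ, ← matFun_mul hρ, ← matFun_mul hρ, ← matFun_mul hσ, matFun_id hρ]
    have e1 : reTr (mlog ρ * ρ * mlog σ) = reTr (ρ * mlog σ * mlog ρ) := by
      unfold reTr
      rw [Matrix.mul_assoc, Matrix.trace_mul_comm]
    change _ = reTr (ρ * mlog ρ * mlog ρ) - reTr (ρ * mlog ρ * mlog σ) -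
      reTr (mlog ρ * ρ * mlog σ) + reTr (ρ * (mlog σ * mlog σ))
    rw [e1, ← reTr_sub, ← reTr_sub, ← reTr_add]
    congr 1
    noncomm_ring
  rw [e, reTr_matFun_eq_sum hρ hσ, reTr_matFun_mul_matFun hρ hσ, reTr_matFun_mul_matFun hρ hσ,
    reTr_mul_matFun hρ hσ, ← Finset.sum_sub_distrib, ← Finset.sum_sub_distrib,
    ← Finset.sum_add_distrib]
  refine Finset.sum_congr rfl fun z _ => ?_
  unfold jointP logRatio
  ring

lemma qV_eq_variance (hρ : IsDensity ρ) (hσ : σ.IsHermitian) :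
    qV ρ σ = ∑ z, jointP ρ σ z * (logRatio ρ σ z - qD ρ σ) ^ 2 := by
  have h : ∀ z, jointP ρ σ z * (logRatio ρ σ z - qD ρ σ) ^ 2 =
      jointP ρ σ z * logRatio ρ σ z ^ 2 - 2 * qD ρ σ * (jointP ρ σ z * logRatio ρ σ z) +
        qD ρ σ ^ 2 * jointP ρ σ z := fun z => by ring
  simp_rw [h]
  rw [Finset.sum_add_distrib, Finset.sum_sub_distrib, ← Finset.mul_sum, ← Finset.mul_sum,
    sum_jointP hρ, ← qD_eq_sum hρ.1.1 hσ, qV_eq_sum hρ.1.1 hσ]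
  ring

lemma qD_nonneg (hρ : IsDensity ρ) (hσ : IsDensity σ) (h : AbsCont ρ σ) : 0 ≤ qD ρ σ := by
  rw [qD_eq_sum hρ.1.1 hσ.1.1]
  have h0 : ∑ z, (jointP ρ σ z - jointQ ρ σ z) = 0 := by
    rw [Finset.sum_sub_distrib, sum_jointP hρ, sum_jointQ hσ, sub_self]
  rw [← h0]
  refine Finset.sum_le_sum fun z _ => ?_
  rcases (jointP_nonneg hρ.1 z (σ := σ)).eq_or_lt with hz | hz
  · rw [← hz]
    have := jointQ_nonneg hσ.1 z (ρ := ρ)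
    linarith
  · have hκ : 0 < eigV σ z.2 :=
      lt_of_le_of_ne (eigV_nonneg hσ.1 _) fun h' => hz.ne' (h z h'.symm)
    have hw : 0 < overlap (eigU ρ) (eigU σ) z.1 z.2 :=
      pos_of_mul_pos_right hz (eigV_nonneg hρ.1 _)
    have hl : 0 < eigV ρ z.1 := pos_of_mul_pos_left hz hw.le
    have h1 := Real.log_le_sub_one_of_pos (div_pos hκ hl)
    rw [Real.log_div hκ.ne' hl.ne'] at h1
    have h2 : 1 - eigV σ z.2 / eigV ρ z.1 ≤ logRatio ρ σ z := by
      unfold logRatio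
      linarith
    have h3 := mul_le_mul_of_nonneg_left h2 hz.le
    refine le_trans (le_of_eq ?_) h3
    unfold jointP jointQ
    field_simp

lemma absCont_of_smul_le (hρ : ρ.PosSemidef) (hσ : σ.PosSemidef) {c : ℝ} (hc : 0 < c)
    (h : (σ - (c : ℂ) • ρ).PosSemidef) : AbsCont ρ σ := by
  let g : ℝ → ℝ := fun t => if t = 0 then 1 else 0
  have hg : (matFun g σ).PosSemidef := by
    rw [matFun_eq hσ.1]
    refine PosSemidef.mul_mul_conjTranspose_same (posSemidef_diagonal_iff.2 fun i => ?_) _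
    refine Complex.zero_le_real.2 ?_
    simp only [g]
    split_ifs <;> norm_num
  have h1 := reTr_mul_nonneg h hg
  have h2 : reTr (σ * matFun g σ) = 0 := by
    conv_lhs => enter [1, 1]; rw [← matFun_id hσ.1]
    rw [matFun_mul hσ.1, reTr_matFun hσ.1]
    refine Finset.sum_eq_zero fun i _ => ?_
    simp only [g]
    split_ifs with h' <;> simp [h']
  rw [Matrix.sub_mul, reTr_sub, h2, Matrix.smul_mul, reTr_smul, reTr_mul_matFun hρ.1 hσ.1] at h1
  have h4 : ∀ z ∈ (Finset.univ : Finset (Fin d × Fin d)),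
      0 ≤ jointP ρ σ z * g (eigV σ z.2) := by
    intro z _
    refine mul_nonneg (jointP_nonneg hρ z) ?_
    simp only [g]
    split_ifs <;> norm_num
  have h3 : ∑ z, jointP ρ σ z * g (eigV σ z.2) = 0 := by
    refine le_antisymm ?_ (Finset.sum_nonneg h4)
    by_contra! hcon
    have := mul_pos hc hcon
    linarith
  intro z hz
  have := (Finset.sum_eq_zero_iff_of_nonneg h4).1 h3 z (Finset.mem_univ z)
  simpa [g, hz] using this

end NussbaumSzkola

section Tensor
open Matrix

variable {d n : ℕ}

lemma tensorSeq_mul (A B : Fin n → Matrix (Fin d) (Fin d) ℂ) :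
    tensorSeq (fun k => A k * B k) = tensorSeq A * tensorSeq B := by
  ext i j
  simp only [tensorSeq, Matrix.of_apply, Matrix.mul_apply, ← Finset.prod_mul_distrib]
  rw [Finset.prod_univ_sum, Fintype.piFinset_univ]

lemma tensorSeq_conjTranspose (A : Fin n → Matrix (Fin d) (Fin d) ℂ) :
    tensorSeq (fun k => (A k)ᴴ) = (tensorSeq A)ᴴ := by
  ext i j
  simp [tensorSeq]

lemma tensorSeq_diagonal (a : Fin n → Fin d → ℂ) :
    tensorSeq (fun k => diagonal (a k)) = diagonal (fun i => ∏ k, a k (i k)) := by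
  ext i j
  simp only [tensorSeq, Matrix.of_apply, Matrix.diagonal_apply]
  by_cases h : i = j
  · simp [h]
  · obtain ⟨k, hk⟩ := Function.ne_iff.1 h
    rw [if_neg h]
    exact Finset.prod_eq_zero (Finset.mem_univ k) (if_neg hk)

lemma tensorSeq_one : tensorSeq (fun _ : Fin n => (1 : Matrix (Fin d) (Fin d) ℂ)) = 1 := by
  simpa using tensorSeq_diagonal (fun (_ : Fin n) (_ : Fin d) => (1 : ℂ))

lemma tensorSeq_eig {A : Fin n → Matrix (Fin d) (Fin d) ℂ} (hA : ∀ k, (A k).IsHermitian) :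
    tensorSeq A = tensorSeq (fun k => eigU (A k)) *
      diagonal (fun i => ((∏ k, eigV (A k) (i k) : ℝ) : ℂ)) *
        (tensorSeq fun k => eigU (A k))ᴴ := by
  conv_lhs => rw [show A = fun k => eigU (A k) * diagonal (fun i => (eigV (A k) i : ℂ)) *
    (eigU (A k))ᴴ from funext fun k => eq_eig (hA k)]
  rw [tensorSeq_mul, tensorSeq_mul, tensorSeq_conjTranspose, tensorSeq_diagonal]
  push_cast
  rfl

lemma tensorSeq_mul_conjTranspose {U : Fin n → Matrix (Fin d) (Fin d) ℂ}
    (hU : ∀ k, U k * (U k)ᴴ = 1) : tensorSeq U * (tensorSeq U)ᴴ = 1 := by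
  rw [← tensorSeq_conjTranspose, ← tensorSeq_mul]
  simp_rw [hU]
  exact tensorSeq_one

lemma overlap_tensorSeq (U V : Fin n → Matrix (Fin d) (Fin d) ℂ) (i j : Fin n → Fin d) :
    overlap (tensorSeq U) (tensorSeq V) i j = ∏ k, overlap (U k) (V k) (i k) (j k) := by
  unfold overlap
  rw [← tensorSeq_conjTranspose, ← tensorSeq_mul]
  simp [tensorSeq, map_prod]

lemma tensorSeq_posSemidef {A : Fin n → Matrix (Fin d) (Fin d) ℂ} (hA : ∀ k, (A k).PosSemidef) :
    (tensorSeq A).PosSemidef := by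
  rw [tensorSeq_eig fun k => (hA k).1]
  refine PosSemidef.mul_mul_conjTranspose_same (posSemidef_diagonal_iff.2 fun i => ?_) _
  exact Complex.zero_le_real.2 (Finset.prod_nonneg fun k _ => eigV_nonneg (hA k) _)

lemma reTr_tensorSeq {A : Fin n → Matrix (Fin d) (Fin d) ℂ} (hA : ∀ k, IsDensity (A k)) :
    reTr (tensorSeq A) = 1 := by
  have : (tensorSeq A).trace = ∏ k, (A k).trace := by
    simp only [Matrix.trace, tensorSeq, Matrix.diag_apply, Matrix.of_apply]
    rw [Finset.prod_univ_sum, Fintype.piFinset_univ]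
  unfold reTr
  rw [this]
  simp [fun k => (hA k).2]

/-- Probability, under a product of weights, that a sum of independent terms is at most `c`. -/
def lowerTail {Z : Type} [Fintype Z] (p Y : Fin n → Z → ℝ) (c : ℝ) : ℝ :=
  ∑ z : Fin n → Z, if ∑ k, Y k (z k) ≤ c then ∏ k, p k (z k) else 0

/-- Hypothesis testing converse for product states in terms of Nussbaum–Szkoła distributions. -/
lemma half_lowerTail_le {ρ : Fin n → Matrix (Fin d) (Fin d) ℂ} {σ : Matrix (Fin d) (Fin d) ℂ}
    (hρ : ∀ k, (ρ k).PosSemidef) (hσ : σ.PosSemidef) (h : ∀ k, AbsCont (ρ k) σ) (c : ℝ)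
    {Q : Matrix (Fin n → Fin d) (Fin n → Fin d) ℂ} (hQ : Q.PosSemidef)
    (hQ1 : (1 - Q).PosSemidef) :
    1 / 2 * lowerTail (fun k => jointP (ρ k) σ) (fun k => logRatio (ρ k) σ) c ≤
      reTr ((1 - Q) * tensorSeq ρ) + Real.exp c * reTr (Q * tensorPow σ n) := by
  have key := half_sum_min_le (U := tensorSeq fun k => eigU (ρ k))
    (V := tensorSeq fun _ : Fin n => eigU σ) (Q := Q)
    (tensorSeq_mul_conjTranspose fun k => eigU_mul_conjTranspose _)
    (tensorSeq_mul_conjTranspose fun k => eigU_mul_conjTranspose _)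
    (a := fun i => ∏ k, eigV (ρ k) (i k))
    (b := fun j => Real.exp c * ∏ k, eigV σ (j k))
    (fun i => Finset.prod_nonneg fun k _ => eigV_nonneg (hρ k) _)
    (fun j => mul_nonneg (Real.exp_pos c).le (Finset.prod_nonneg fun k _ => eigV_nonneg hσ _))
    hQ hQ1
  have e2 : reTr (Q * ((tensorSeq fun _ : Fin n => eigU σ) *
      diagonal (fun j => ((Real.exp c * ∏ k, eigV σ (j k) : ℝ) : ℂ)) *
        (tensorSeq fun _ : Fin n => eigU σ)ᴴ)) = Real.exp c * reTr (Q * tensorPow σ n) := by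
    rw [← reTr_smul, ← Matrix.mul_smul, tensorPow, tensorSeq_eig fun _ => hσ.1, ← Matrix.smul_mul,
      ← Matrix.mul_smul, ← Matrix.diagonal_smul]
    congr 6
    ext j
    simp
  rw [e2, ← tensorSeq_eig fun k => (hρ k).1] at key
  refine le_trans ?_ key
  refine mul_le_mul_of_nonneg_left ?_ (by norm_num)
  rw [← Fintype.sum_prod_type', ← (Equiv.arrowProdEquivProdArrow (Fin n) (fun _ => Fin d)
    (fun _ => Fin d)).sum_comp]
  refine Finset.sum_le_sum fun z _ => ?_
  simp only [Equiv.arrowProdEquivProdArrow, Equiv.coe_fn_mk, overlap_tensorSeq]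
  set w : Fin n → ℝ := fun k => overlap (eigU (ρ k)) (eigU σ) (z k).1 (z k).2 with hw
  have hw0 : 0 ≤ ∏ k, w k := Finset.prod_nonneg fun k _ => overlap_nonneg _ _ _ _
  have ha0 : 0 ≤ ∏ k, eigV (ρ k) (z k).1 := Finset.prod_nonneg fun k _ => eigV_nonneg (hρ k) _
  have hb0 : 0 ≤ ∏ k, eigV σ (z k).2 := Finset.prod_nonneg fun k _ => eigV_nonneg hσ _
  have hmin : 0 ≤ min (∏ k, eigV (ρ k) (z k).1) (Real.exp c * ∏ k, eigV σ (z k).2) * ∏ k, w k :=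
    mul_nonneg (le_min ha0 (mul_nonneg (Real.exp_pos c).le hb0)) hw0
  have hP : ∏ k, jointP (ρ k) σ (z k) = (∏ k, eigV (ρ k) (z k).1) * ∏ k, w k := by
    rw [← Finset.prod_mul_distrib]
    rfl
  split_ifs with hc
  · by_cases hz : ∀ k, jointP (ρ k) σ (z k) ≠ 0
    · have hl : ∀ k, 0 < eigV (ρ k) (z k).1 := fun k =>
        lt_of_le_of_ne (eigV_nonneg (hρ k) _) fun h' => hz k (by simp [jointP, ← h'])
      have hk : ∀ k, 0 < eigV σ (z k).2 := fun k =>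
        lt_of_le_of_ne (eigV_nonneg hσ _) fun h' => hz k (h k _ h'.symm)
      have hlog : Real.log (∏ k, eigV (ρ k) (z k).1) - Real.log (∏ k, eigV σ (z k).2) ≤ c := by
        rw [Real.log_prod fun k _ => (hl k).ne', Real.log_prod fun k _ => (hk k).ne',
          ← Finset.sum_sub_distrib]
        exact hc
      have hle : ∏ k, eigV (ρ k) (z k).1 ≤ Real.exp c * ∏ k, eigV σ (z k).2 := by
        rw [← Real.log_le_log_iff (Finset.prod_pos fun k _ => hl k)
          (mul_pos (Real.exp_pos c) (Finset.prod_pos fun k _ => hk k)),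
          Real.log_mul (Real.exp_pos c).ne' (Finset.prod_pos fun k _ => hk k).ne', Real.log_exp]
        linarith
      rw [min_eq_left hle, hP]
    · push Not at hz
      obtain ⟨k, hk⟩ := hz
      rw [Finset.prod_eq_zero (Finset.mem_univ k) hk]
      exact hmin
  · exact hmin

end Tensor

section IndependentSums

variable {Z : Type} [Fintype Z] {n : ℕ}

lemma sum_prod_apply (g : Fin n → Z → ℝ) :
    ∑ z : Fin n → Z, ∏ k, g k (z k) = ∏ k, ∑ x, g k x := by
  rw [Finset.prod_univ_sum, Fintype.piFinset_univ]

lemma sum_prod_mul_apply {p : Fin n → Z → ℝ} (hp : ∀ k, ∑ x, p k x = 1) (j : Fin n) (g : Z → ℝ) :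
    ∑ z : Fin n → Z, (∏ k, p k (z k)) * g (z j) = ∑ x, p j x * g x := by
  have h : ∀ z : Fin n → Z, (∏ k, p k (z k)) * g (z j) =
      ∏ k, p k (z k) * (if k = j then g (z k) else 1) := by
    intro z
    rw [Finset.prod_mul_distrib, Finset.prod_ite_eq' Finset.univ j fun k => g (z k)]
    simp
  simp_rw [h]
  rw [sum_prod_apply fun k x => p k x * (if k = j then g x else 1),
    Finset.prod_eq_single j]
  · simp
  · intro k _ hk
    simp [hk, hp]
  · simp

lemma sum_prod_mul_sq {p Y : Fin n → Z → ℝ} (hp : ∀ k, ∑ x, p k x = 1)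
    (hY : ∀ k, ∑ x, p k x * Y k x = 0) :
    ∑ z : Fin n → Z, (∏ k, p k (z k)) * (∑ k, Y k (z k)) ^ 2 = ∑ k, ∑ x, p k x * Y k x ^ 2 := by
  have h : ∀ i j, ∑ z : Fin n → Z, (∏ k, p k (z k)) * (Y i (z i) * Y j (z j)) =
      if i = j then ∑ x, p i x * Y i x ^ 2 else 0 := by
    intro i j
    split_ifs with hij
    · subst hij
      rw [← sum_prod_mul_apply hp i]
      simp_rw [sq]
    · have h : ∀ z : Fin n → Z, (∏ k, p k (z k)) * (Y i (z i) * Y j (z j)) =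
          ∏ k, p k (z k) * ((if k = i then Y k (z k) else 1) *
            (if k = j then Y k (z k) else 1)) := by
        intro z
        rw [Finset.prod_mul_distrib, Finset.prod_mul_distrib,
          Finset.prod_ite_eq' Finset.univ i fun k => Y k (z k),
          Finset.prod_ite_eq' Finset.univ j fun k => Y k (z k)]
        simp
      simp_rw [h]
      rw [sum_prod_apply fun k x => p k x * ((if k = i then Y k x else 1) *
            (if k = j then Y k x else 1)), Finset.prod_eq_zero (Finset.mem_univ i)]
      simp [hij, hY]
  simp_rw [sq (∑ k, Y k _), Finset.sum_mul_sum, Finset.mul_sum]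
  rw [Finset.sum_comm]
  refine Finset.sum_congr rfl fun i _ => ?_
  rw [Finset.sum_comm]
  simp_rw [h]
  simp

lemma one_sub_le_lowerTail {p Y : Fin n → Z → ℝ} (hp0 : ∀ k x, 0 ≤ p k x)
    (hp : ∀ k, ∑ x, p k x = 1) (hY : ∀ k, ∑ x, p k x * Y k x = 0) {t : ℝ} (ht : 0 < t) :
    1 - (∑ k, ∑ x, p k x * Y k x ^ 2) / t ^ 2 ≤ lowerTail p Y t := by
  have h1 : ∑ z : Fin n → Z, ∏ k, p k (z k) = 1 := by
    rw [sum_prod_apply]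
    simp [hp]
  rw [← sum_prod_mul_sq hp hY, ← h1, Finset.sum_div, ← Finset.sum_sub_distrib]
  refine Finset.sum_le_sum fun z _ => ?_
  have hP : 0 ≤ ∏ k, p k (z k) := Finset.prod_nonneg fun k _ => hp0 k _
  split_ifs with hc
  · have : 0 ≤ (∏ k, p k (z k)) * (∑ k, Y k (z k)) ^ 2 / t ^ 2 := by positivity
    linarith
  · have h2 : 1 ≤ (∑ k, Y k (z k)) ^ 2 / t ^ 2 := by
      rw [one_le_div (by positivity)]
      push Not at hc
      gcongr
    have := mul_le_mul_of_nonneg_left h2 hP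
    rw [mul_div_assoc]
    linarith

lemma lowerTail_mono {p Y : Fin n → Z → ℝ} (hp0 : ∀ k x, 0 ≤ p k x) {b c : ℝ} (hbc : b ≤ c) :
    lowerTail p Y b ≤ lowerTail p Y c := by
  refine Finset.sum_le_sum fun z _ => ?_
  have hP : 0 ≤ ∏ k, p k (z k) := Finset.prod_nonneg fun k _ => hp0 k _
  split_ifs with h1 h2 h2
  · exact le_rfl
  · exact absurd (h1.trans hbc) h2
  · exact hP
  · exact le_rfl

lemma lowerTail_sub_const (p Y : Fin n → Z → ℝ) (m : Fin n → ℝ) (c : ℝ) :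
    lowerTail p (fun k x => Y k x - m k) (c - ∑ k, m k) = lowerTail p Y c := by
  unfold lowerTail
  simp only [Finset.sum_sub_distrib, sub_le_sub_iff_right]

lemma one_sub_mul_log_le {x : ℝ} (hx : |x| ≤ 1 / 2) :
    (1 - x) * Real.log (1 - x) ≤ -x + x ^ 2 / 2 + 4 * |x| ^ 3 := by
  have h := Real.abs_log_sub_add_sum_range_le (lt_of_le_of_lt hx (by norm_num)) 2
  have h1 := (abs_le.1 h).2
  simp only [Finset.sum_range_succ, Finset.sum_range_zero] at h1
  norm_num at h1
  have h2 : |x| ^ 3 / (1 - |x|) ≤ 2 * |x| ^ 3 := by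
    rw [div_le_iff₀ (by linarith)]
    nlinarith [pow_nonneg (abs_nonneg x) 3]
  have h3 : Real.log (1 - x) ≤ -x - x ^ 2 / 2 + 2 * |x| ^ 3 := by linarith
  have hx' := abs_le.1 hx
  have h4 := mul_le_mul_of_nonneg_left h3 (by linarith : 0 ≤ 1 - x)
  refine h4.trans ?_
  have h5 : x ^ 3 ≤ |x| ^ 3 := by
    rw [← abs_pow]
    exact le_abs_self _
  have h6 := pow_nonneg (abs_nonneg x) 3
  nlinarith

/-- Lower bound on moderate deviation probabilities of sums of independent bounded centred
variables, by the linear change of measure with density `1 - s Y`. -/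
lemma exp_neg_le_lowerTail {p Y : Fin n → Z → ℝ} (hp0 : ∀ k x, 0 ≤ p k x)
    (hp : ∀ k, ∑ x, p k x = 1) (hY : ∀ k, ∑ x, p k x * Y k x = 0) {B : ℝ}
    (hB : ∀ k x, |Y k x| ≤ B) {s t θ S : ℝ} (hs : 0 ≤ s) (hsB : s * B ≤ 1 / 2) (ht : 0 < t)
    (hθ : 0 ≤ θ) (hS : ∑ k, ∑ x, p k x * Y k x ^ 2 = S)
    (h : s ^ 2 * S / 2 + 4 * s ^ 3 * B * S + 2 ≤ θ * (1 - 2 * S / t ^ 2)) :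
    Real.exp (-θ) ≤ lowerTail p Y (-(s * S) + t) := by
  set m : Fin n → ℝ := fun k => ∑ x, p k x * Y k x ^ 2 with hm
  have hm0 : ∀ k, 0 ≤ m k := fun k => Finset.sum_nonneg fun x _ => mul_nonneg (hp0 k x) (sq_nonneg _)
  have hsY : ∀ k x, |s * Y k x| ≤ 1 / 2 := fun k x => by
    rw [abs_mul, abs_of_nonneg hs]
    exact (mul_le_mul_of_nonneg_left (hB k x) hs).trans hsB
  have hr : ∀ k x, 0 < 1 - s * Y k x := fun k x => by
    have := (abs_le.1 (hsY k x)).2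
    linarith
  set q : Fin n → Z → ℝ := fun k x => p k x * (1 - s * Y k x) with hq
  have hq0 : ∀ k x, 0 ≤ q k x := fun k x => mul_nonneg (hp0 k x) (hr k x).le
  have hqs : ∀ k, ∑ x, q k x = 1 := fun k => by
    have : ∀ x, q k x = p k x - s * (p k x * Y k x) := fun x => by simp only [hq]; ring
    simp_rw [this]
    rw [Finset.sum_sub_distrib, ← Finset.mul_sum, hp, hY]
    ring
  have hqY : ∀ k, ∑ x, q k x * Y k x = -(s * m k) := fun k => by
    have : ∀ x, q k x * Y k x = p k x * Y k x - s * (p k x * Y k x ^ 2) :=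
      fun x => by simp only [hq]; ring
    simp_rw [this]
    rw [Finset.sum_sub_distrib, ← Finset.mul_sum, hY]
    simp [hm]
  have hqc : ∀ k, ∑ x, q k x * (Y k x - -(s * m k)) = 0 := fun k => by
    simp_rw [mul_sub]
    rw [Finset.sum_sub_distrib, ← Finset.sum_mul, hqY, hqs]
    ring
  have hqv : ∀ k, ∑ x, q k x * (Y k x - -(s * m k)) ^ 2 ≤ 2 * m k := fun k => by
    have e : ∀ x, q k x * (Y k x - -(s * m k)) ^ 2 =
      q k x * Y k x ^ 2 + 2 * (s * m k) * (q k x * Y k x) + (s * m k) ^ 2 * q k x :=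
        fun x => by ring
    simp_rw [e]
    rw [Finset.sum_add_distrib, Finset.sum_add_distrib, ← Finset.mul_sum, ← Finset.mul_sum,
      hqY, hqs]
    have h1 : ∑ x, q k x * Y k x ^ 2 ≤ 2 * m k := by
      rw [hm, Finset.mul_sum]
      refine Finset.sum_le_sum fun x _ => ?_
      have h2 := (abs_le.1 (hsY k x)).1
      have h3 : 0 ≤ p k x * Y k x ^ 2 := mul_nonneg (hp0 k x) (sq_nonneg _)
      have : q k x * Y k x ^ 2 = p k x * Y k x ^ 2 * (1 - s * Y k x) := by simp only [hq]; ring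
      rw [this]
      nlinarith
    nlinarith [sq_nonneg (s * m k)]
  have hQA : 1 - 2 * S / t ^ 2 ≤ lowerTail q Y (-(s * S) + t) := by
    have h1 := one_sub_le_lowerTail (Y := fun k x => Y k x - -(s * m k)) hq0 hqs hqc ht
    have h2 := lowerTail_sub_const q Y (fun k => -(s * m k)) (-(s * S) + t)
    have h3 : -(s * S) + t - ∑ k, -(s * m k) = t := by
      rw [Finset.sum_neg_distrib, ← Finset.mul_sum, hS]
      ring
    rw [h3] at h2
    rw [← h2]
    refine le_trans ?_ h1
    have h4 : ∑ k, ∑ x, q k x * (Y k x - -(s * m k)) ^ 2 ≤ 2 * S := by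
      rw [← hS, Finset.mul_sum]
      exact Finset.sum_le_sum fun k _ => hqv k
    gcongr
  set D : ℝ := ∑ z : Fin n → Z, (∏ k, q k (z k)) * ∑ k, Real.log (1 - s * Y k (z k)) with hD
  have hDle : D ≤ s ^ 2 * S / 2 + 4 * s ^ 3 * B * S := by
    have e : D = ∑ k, ∑ x, q k x * Real.log (1 - s * Y k x) := by
      simp_rw [hD, Finset.mul_sum]
      rw [Finset.sum_comm]
      exact Finset.sum_congr rfl fun k _ =>
        sum_prod_mul_apply hqs k fun x => Real.log (1 - s * Y k x)
    have e2 : s ^ 2 * S / 2 + 4 * s ^ 3 * B * S =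
        ∑ k, (s ^ 2 / 2 * m k + 4 * s ^ 3 * B * m k) := by
      rw [Finset.sum_add_distrib, ← Finset.mul_sum, ← Finset.mul_sum, hS]
      ring
    rw [e, e2]
    refine Finset.sum_le_sum fun k _ => ?_
    have e3 : s ^ 2 / 2 * m k + 4 * s ^ 3 * B * m k = ∑ x, (-s * (p k x * Y k x) +
        s ^ 2 / 2 * (p k x * Y k x ^ 2) + 4 * s ^ 3 * B * (p k x * Y k x ^ 2)) := by
      rw [Finset.sum_add_distrib, Finset.sum_add_distrib, ← Finset.mul_sum, ← Finset.mul_sum,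
        ← Finset.mul_sum, hY]
      ring
    rw [e3]
    refine Finset.sum_le_sum fun x _ => ?_
    have h1 := mul_le_mul_of_nonneg_left (one_sub_mul_log_le (hsY k x)) (hp0 k x)
    have h2 : |s * Y k x| ^ 3 ≤ s ^ 3 * B * Y k x ^ 2 := by
      rw [abs_mul, abs_of_nonneg hs, mul_pow, mul_assoc]
      refine mul_le_mul_of_nonneg_left ?_ (pow_nonneg hs 3)
      rw [pow_succ' |Y k x|, sq_abs]
      exact mul_le_mul_of_nonneg_right (hB k x) (sq_nonneg _)
    have h3 := mul_le_mul_of_nonneg_left h2 (hp0 k x)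
    simp only [hq]
    nlinarith
  have hpt : ∀ z : Fin n → Z, Real.exp (-θ) *
      (θ * (if ∑ k, Y k (z k) ≤ -(s * S) + t then ∏ k, q k (z k) else 0) -
        (∏ k, q k (z k)) * ∑ k, Real.log (1 - s * Y k (z k)) - ∏ k, p k (z k)) ≤
      if ∑ k, Y k (z k) ≤ -(s * S) + t then ∏ k, p k (z k) else 0 := by
    intro z
    set l : ℝ := ∑ k, Real.log (1 - s * Y k (z k)) with hl
    have hP0 : 0 ≤ ∏ k, p k (z k) := Finset.prod_nonneg fun k _ => hp0 k _
    have hexp : ∏ k, (1 - s * Y k (z k)) = Real.exp l := by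
      rw [hl, Real.exp_sum]
      exact Finset.prod_congr rfl fun k _ => (Real.exp_log (hr k _)).symm
    have hqz : ∏ k, q k (z k) = (∏ k, p k (z k)) * Real.exp l := by
      rw [← hexp, ← Finset.prod_mul_distrib]
    have hel : Real.exp l * Real.exp (-l) = 1 := by rw [← Real.exp_add]; simp
    have hθl : Real.exp (-θ) * Real.exp (θ - l) = Real.exp (-l) := by
      rw [← Real.exp_add]
      ring_nf
    rw [hqz]
    split_ifs with hc
    · have h1 := Real.add_one_le_exp (θ - l)
      have h2 : Real.exp l * (θ - l) ≤ Real.exp l * Real.exp (θ - l) :=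
        mul_le_mul_of_nonneg_left (by linarith) (Real.exp_pos l).le
      have h3 : Real.exp (-θ) * (Real.exp l * (θ - l) - 1) ≤ 1 := by
        have h4 := mul_le_mul_of_nonneg_left h2 (Real.exp_pos (-θ)).le
        have h5 : Real.exp (-θ) * (Real.exp l * Real.exp (θ - l)) = 1 := by
          rw [← hel, ← hθl]
          ring
        have := Real.exp_pos (-θ)
        linarith
      have h6 := mul_le_mul_of_nonneg_left h3 hP0
      linarith
    · have h1 := Real.add_one_le_exp (-l)
      have h2 : Real.exp l * -l ≤ Real.exp l * Real.exp (-l) :=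
        mul_le_mul_of_nonneg_left (by linarith) (Real.exp_pos l).le
      rw [hel] at h2
      have h3 := mul_le_mul_of_nonneg_left h2 hP0
      refine mul_nonpos_of_nonneg_of_nonpos (Real.exp_pos _).le ?_
      linarith
  have hsum := Finset.sum_le_sum fun z (_ : z ∈ Finset.univ) => hpt z
  rw [← Finset.mul_sum, Finset.sum_sub_distrib, Finset.sum_sub_distrib, ← Finset.mul_sum,
    ← hD, sum_prod_apply p] at hsum
  simp only [hp, Finset.prod_const_one] at hsum
  change Real.exp (-θ) * (θ * lowerTail q Y (-(s * S) + t) - D - 1) ≤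
    lowerTail p Y (-(s * S) + t) at hsum
  refine le_trans ?_ hsum
  refine le_mul_of_one_le_right (Real.exp_pos _).le ?_
  have := mul_le_mul_of_nonneg_left hQA hθ
  linarith

end IndependentSums

section Channels

open Matrix Set

variable {X : Type} [Fintype X] {d : ℕ} {W : X → Matrix (Fin d) (Fin d) ℂ} {P Q : X → ℝ}

lemma avgState_posSemidef (hW : ∀ x, (W x).PosSemidef) (hP : ∀ x, 0 ≤ P x) :
    (avgState P W).PosSemidef := by
  unfold avgState
  exact posSemidef_sum _ fun x _ => (hW x).smul (Complex.zero_le_real.2 (hP x))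

lemma avgState_isDensity (hW : ∀ x, IsDensity (W x)) (hP : IsProbDist P) :
    IsDensity (avgState P W) := by
  refine ⟨avgState_posSemidef (fun x => (hW x).1) hP.1, ?_⟩
  unfold avgState
  rw [trace_sum]
  simp only [trace_smul, (hW _).2, smul_eq_mul, mul_one]
  rw [← Complex.ofReal_sum, hP.2, Complex.ofReal_one]

lemma avgState_single [DecidableEq X] (x : X) : avgState (Pi.single x 1) W = W x := by
  unfold avgState
  rw [Finset.sum_eq_single x]
  · simp
  · intro y _ hy
    simp [hy]
  · simp

lemma continuous_avgState (W : X → Matrix (Fin d) (Fin d) ℂ) :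
    Continuous fun P : X → ℝ => avgState P W := by
  unfold avgState
  fun_prop

lemma absCont_avgState (hW : ∀ x, (W x).PosSemidef) (hP : ∀ x, 0 ≤ P x) (hQ : ∀ x, 0 ≤ Q x)
    {c : ℝ} (hc : 0 < c) (h : ∀ x, c * P x ≤ Q x) : AbsCont (avgState P W) (avgState Q W) := by
  refine absCont_of_smul_le (avgState_posSemidef hW hP) (avgState_posSemidef hW hQ) hc ?_
  have : avgState Q W - (c : ℂ) • avgState P W = avgState (fun x => Q x - c * P x) W := by
    unfold avgState
    rw [Finset.smul_sum, ← Finset.sum_sub_distrib]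
    refine Finset.sum_congr rfl fun x _ => ?_
    rw [smul_smul, ← sub_smul]
    push_cast
    rfl
  rw [this]
  exact avgState_posSemidef hW fun x => sub_nonneg.2 (h x)

lemma absCont_avgState_of_pos (hW : ∀ x, (W x).PosSemidef) (hQ : ∀ x, 0 ≤ Q x) {x : X}
    (hx : 0 < Q x) : AbsCont (W x) (avgState Q W) := by
  classical
  rw [← avgState_single (W := W) x]
  refine absCont_avgState hW (fun y => ?_) hQ hx fun y => ?_
  · rcases eq_or_ne y x with rfl | hy <;> simp [*]
  · rcases eq_or_ne y x with rfl | hy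
    · simp
    · simpa [hy] using hQ y

lemma reTr_avgState_mul (P : X → ℝ) (B : Matrix (Fin d) (Fin d) ℂ) :
    reTr (avgState P W * B) = ∑ x, P x * reTr (W x * B) := by
  unfold avgState
  rw [Finset.sum_mul, reTr_sum]
  simp only [Matrix.smul_mul, reTr_smul]

lemma sum_mul_qD (P : X → ℝ) (σ : Matrix (Fin d) (Fin d) ℂ) :
    ∑ x, P x * qD (W x) σ =
      ∑ x, P x * reTr (W x * mlog (W x)) - reTr (avgState P W * mlog σ) := by
  rw [reTr_avgState_mul, ← Finset.sum_sub_distrib]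
  refine Finset.sum_congr rfl fun x _ => ?_
  unfold qD
  rw [Matrix.mul_sub, reTr_sub]
  ring

lemma sum_mul_qD_eq_mutualInfo_add (P : X → ℝ) (σ : Matrix (Fin d) (Fin d) ℂ) :
    ∑ x, P x * qD (W x) σ = mutualInfo P W + qD (avgState P W) σ := by
  unfold mutualInfo
  rw [sum_mul_qD, sum_mul_qD, qD, Matrix.mul_sub, reTr_sub]
  ring

open scoped Matrix.Norms.L2Operator in
lemma continuousOn_matFun_avgState (hW : ∀ x, IsDensity (W x)) {f : ℝ → ℝ} (hf : Continuous f) :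
    ContinuousOn (fun P => matFun f (avgState P W)) (stdSimplex ℝ X) := by
  have h : ContinuousOn (fun P => cfc f (avgState P W)) (stdSimplex ℝ X) := by
    refine ContinuousOn.cfc' (isCompact_Icc (a := (0 : ℝ)) (b := 1)) f
      (continuous_avgState W).continuousOn ?_ ?_ hf.continuousOn
    · intro P hP
      have hd := avgState_isDensity hW hP
      rw [hd.1.1.spectrum_real_eq_range_eigenvalues]
      rintro _ ⟨i, rfl⟩
      have h0 := eigV_nonneg hd.1 i
      have h1 := eigV_le_one hd i
      unfold eigV at h0 h1
      rw [dif_pos hd.1.1] at h0 h1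
      exact ⟨h0, h1⟩
    · exact fun P hP => (avgState_isDensity hW hP).1.1
  refine h.congr fun P hP => ?_
  have hd := avgState_isDensity hW hP
  simp only [matFun, dif_pos hd.1.1, hd.1.1.cfc_eq]

lemma continuous_reTr {ι : Type} [Fintype ι] : Continuous (reTr : Matrix ι ι ℂ → ℝ) := by
  unfold reTr
  fun_prop

lemma continuousOn_mutualInfo (hW : ∀ x, IsDensity (W x)) :
    ContinuousOn (fun P => mutualInfo P W) (stdSimplex ℝ X) := by
  have h : ∀ P ∈ stdSimplex ℝ X, mutualInfo P W = ∑ x, P x * reTr (W x * mlog (W x)) -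
      reTr (matFun (fun t => t * Real.log t) (avgState P W)) := by
    intro P hP
    have hd := avgState_isDensity hW hP
    unfold mutualInfo
    rw [sum_mul_qD]
    congr 2
    conv_lhs => enter [1]; rw [← matFun_id hd.1.1]
    exact matFun_mul hd.1.1 _ _
  refine ContinuousOn.congr ?_ h
  refine ContinuousOn.sub (by fun_prop) ?_
  exact continuous_reTr.comp_continuousOn
    (continuousOn_matFun_avgState hW Real.continuous_mul_log)

lemma mutualInfo_le_capacity (hW : ∀ x, IsDensity (W x)) (hP : IsProbDist P) :
    mutualInfo P W ≤ capacity W := by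
  refine le_csSup ?_ ⟨P, hP, rfl⟩
  have := (isCompact_stdSimplex ℝ X).bddAbove_image (continuousOn_mutualInfo hW)
  refine this.mono ?_
  rintro _ ⟨Q, hQ, rfl⟩
  exact ⟨Q, hQ, rfl⟩

lemma isProbDist_mix (hP : IsProbDist P) (hQ : IsProbDist Q) {t : ℝ} (ht0 : 0 ≤ t) (ht1 : t ≤ 1) :
    IsProbDist fun y => (1 - t) * P y + t * Q y := by
  refine ⟨fun y => add_nonneg (mul_nonneg (by linarith) (hP.1 y)) (mul_nonneg ht0 (hQ.1 y)), ?_⟩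
  rw [Finset.sum_add_distrib, ← Finset.mul_sum, ← Finset.mul_sum, hP.2, hQ.2]
  ring

lemma isProbDist_single [DecidableEq X] (x : X) : IsProbDist (Pi.single x 1 : X → ℝ) :=
  ⟨fun y => by rcases eq_or_ne y x with rfl | hy <;> simp [*], by simp⟩

lemma qD_mix_le_capacity [DecidableEq X] (hW : ∀ x, IsDensity (W x)) (hP : IsProbDist P)
    (hC : mutualInfo P W = capacity W) (x : X) {t : ℝ} (ht0 : 0 < t) (ht1 : t < 1) :
    qD (W x) (avgState (fun y => (1 - t) * P y + t * (Pi.single x 1 : X → ℝ) y) W) ≤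
      capacity W := by
  set Q : X → ℝ := fun y => (1 - t) * P y + t * (Pi.single x 1 : X → ℝ) y with hQdef
  have hQ : IsProbDist Q := isProbDist_mix hP (isProbDist_single x) ht0.le ht1.le
  have h1 := mutualInfo_le_capacity hW hQ
  have h2 : mutualInfo Q W = (1 - t) * ∑ y, P y * qD (W y) (avgState Q W) +
      t * qD (W x) (avgState Q W) := by
    unfold mutualInfo
    have : ∀ y, Q y * qD (W y) (avgState Q W) = (1 - t) * (P y * qD (W y) (avgState Q W)) +
        t * ((Pi.single x 1 : X → ℝ) y * qD (W y) (avgState Q W)) := by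
      intro y
      simp only [hQdef]
      ring
    simp only [this]
    rw [Finset.sum_add_distrib, ← Finset.mul_sum, ← Finset.mul_sum]
    congr 2
    rw [Finset.sum_eq_single x (by intro y _ hy; simp [hy]) (by simp)]
    simp
  have h3 : 0 ≤ qD (avgState P W) (avgState Q W) := by
    refine qD_nonneg (avgState_isDensity hW hP) (avgState_isDensity hW hQ)
      (absCont_avgState (fun x => (hW x).1) hP.1 hQ.1 (sub_pos.2 ht1) fun y => ?_)
    exact le_add_of_nonneg_right (mul_nonneg ht0.le ((isProbDist_single x).1 y))
  rw [sum_mul_qD_eq_mutualInfo_add, hC] at h2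
  have h4 : 0 ≤ (1 - t) * qD (avgState P W) (avgState Q W) :=
    mul_nonneg (by linarith) h3
  have h5 : t * qD (W x) (avgState Q W) ≤ t * capacity W := by linarith
  exact le_of_mul_le_mul_left h5 ht0

lemma reTr_mul_cutoff_le (hW : ∀ x, IsDensity (W x)) (hP : IsProbDist P)
    (hC : mutualInfo P W = capacity W) (x : X) (M : ℝ) :
    reTr (W x * matFun (fun t => -Real.log (max t (Real.exp (-M)))) (avgState P W)) ≤
      capacity W - reTr (W x * mlog (W x)) := by
  classical
  set f : ℝ → ℝ := fun t => -Real.log (max t (Real.exp (-M))) with hf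
  have hfc : Continuous f := by
    refine Continuous.neg (Continuous.log (by fun_prop) fun t => ?_)
    exact ((Real.exp_pos _).trans_le (le_max_right _ _)).ne'
  let Q : ℝ → X → ℝ := fun t y => (1 - t) * P y + t * (Pi.single x 1 : X → ℝ) y
  have hQ : MapsTo Q (Icc 0 1) (stdSimplex ℝ X) := fun t ht =>
    isProbDist_mix hP (isProbDist_single x) ht.1 ht.2
  have hQc : Continuous Q := by
    refine continuous_pi fun y => ?_
    fun_prop
  have hcont : ContinuousOn (fun t => reTr (W x * matFun f (avgState (Q t) W))) (Icc 0 1) := by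
    refine continuous_reTr.comp_continuousOn (ContinuousOn.mul continuousOn_const ?_)
    exact (continuousOn_matFun_avgState hW hfc).comp hQc.continuousOn hQ
  have h0 : Q 0 = P := by
    funext y
    simp [Q]
  have hw : ContinuousWithinAt (fun t => reTr (W x * matFun f (avgState (Q t) W))) (Ioo 0 1) 0 :=
    (hcont 0 (by simp)).mono Ioo_subset_Icc_self
  have hcl : (0 : ℝ) ∈ closure (Ioo (0 : ℝ) 1) := by
    rw [closure_Ioo zero_ne_one]
    simp
  have := hw.closure_le hcl (continuousWithinAt_const
    (b := capacity W - reTr (W x * mlog (W x)))) ?_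
  · simpa only [h0] using this
  intro t ht
  have hd := avgState_isDensity hW (hQ (Ioo_subset_Icc_self ht))
  have h1 := qD_mix_le_capacity hW hP hC x ht.1 ht.2
  have hac : AbsCont (W x) (avgState (Q t) W) := by
    refine absCont_avgState_of_pos (fun x => (hW x).1) (hQ (Ioo_subset_Icc_self ht)).1 ?_
    have := mul_nonneg (sub_nonneg.2 ht.2.le) (hP.1 x)
    have := ht.1
    simp only [Q, Pi.single_eq_same]
    linarith
  change qD (W x) (avgState (Q t) W) ≤ _ at h1
  unfold qD at h1
  rw [Matrix.mul_sub, reTr_sub] at h1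
  have h2 : reTr (W x * matFun f (avgState (Q t) W)) ≤
      -reTr (W x * mlog (avgState (Q t) W)) := by
    unfold mlog
    rw [reTr_mul_matFun (hW x).1.1 hd.1.1, reTr_mul_matFun (hW x).1.1 hd.1.1,
      ← Finset.sum_neg_distrib]
    refine Finset.sum_le_sum fun z _ => ?_
    rcases (eigV_nonneg hd.1 z.2).eq_or_lt with hz | hz
    · simp [hac z hz.symm]
    · rw [← mul_neg]
      refine mul_le_mul_of_nonneg_left ?_ (jointP_nonneg (hW x).1 z)
      exact neg_le_neg (Real.log_le_log hz (le_max_left _ _))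
  linarith

/-- The output state of a capacity-achieving distribution dominates every channel output. -/
lemma absCont_of_mutualInfo_eq_capacity (hW : ∀ x, IsDensity (W x)) (hP : IsProbDist P)
    (hC : mutualInfo P W = capacity W) (x : X) : AbsCont (W x) (avgState P W) := by
  have hd := avgState_isDensity hW hP
  intro z hz
  refine le_antisymm ?_ (jointP_nonneg (hW x).1 z)
  set c := capacity W - reTr (W x * mlog (W x)) with hc
  have key : ∀ M : ℝ, 0 ≤ M → jointP (W x) (avgState P W) z * M ≤ c := by
    intro M hM
    have h := reTr_mul_cutoff_le hW hP hC x M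
    rw [reTr_mul_matFun (hW x).1.1 hd.1.1] at h
    refine le_trans ?_ h
    have h1 : jointP (W x) (avgState P W) z * M = jointP (W x) (avgState P W) z *
        -Real.log (max (eigV (avgState P W) z.2) (Real.exp (-M))) := by
      rw [hz, max_eq_right (Real.exp_pos _).le, Real.log_exp, neg_neg]
    rw [h1]
    refine Finset.single_le_sum (f := fun z => jointP (W x) (avgState P W) z *
        -Real.log (max (eigV (avgState P W) z.2) (Real.exp (-M)))) (fun y _ => ?_)
      (Finset.mem_univ z)
    refine mul_nonneg (jointP_nonneg (hW x).1 y) (neg_nonneg.2 (Real.log_nonpos ?_ ?_))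
    · exact (Real.exp_pos _).le.trans (le_max_right _ _)
    · exact max_le (eigV_le_one hd _) (Real.exp_le_one_iff.2 (by linarith))
  by_contra! hcon
  have h1 := key ((|c| + 1) / jointP (W x) (avgState P W) z) (by positivity)
  rw [mul_div_cancel₀ _ hcon.ne'] at h1
  linarith [le_abs_self c]

lemma qD_le_capacity (hW : ∀ x, IsDensity (W x)) (hP : IsProbDist P)
    (hC : mutualInfo P W = capacity W) (x : X) : qD (W x) (avgState P W) ≤ capacity W := by
  have hd := avgState_isDensity hW hP
  have hac := absCont_of_mutualInfo_eq_capacity hW hP hC x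
  have h := reTr_mul_cutoff_le hW hP hC x (∑ i, |Real.log (eigV (avgState P W) i)|)
  rw [reTr_mul_matFun (hW x).1.1 hd.1.1] at h
  unfold qD
  rw [Matrix.mul_sub, reTr_sub]
  have h2 : -reTr (W x * mlog (avgState P W)) ≤ _ := le_trans (le_of_eq ?_) h
  · linarith
  unfold mlog
  rw [reTr_mul_matFun (hW x).1.1 hd.1.1, ← Finset.sum_neg_distrib]
  refine Finset.sum_congr rfl fun z _ => ?_
  rcases (eigV_nonneg hd.1 z.2).eq_or_lt with hz | hz
  · simp [hac z hz.symm]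
  · rw [max_eq_left, mul_neg]
    rw [← Real.le_log_iff_exp_le hz]
    have := Finset.single_le_sum (f := fun i => |Real.log (eigV (avgState P W) i)|)
      (fun i _ => abs_nonneg _) (Finset.mem_univ z.2)
    have := neg_abs_le (Real.log (eigV (avgState P W) z.2))
    linarith

end Channels

section WordTail

variable {X : Type} {d n : ℕ} {W : X → Matrix (Fin d) (Fin d) ℂ} {σ : Matrix (Fin d) (Fin d) ℂ}

/-- Lower tail of the log-likelihood ratio of a channel word against an i.i.d. state. -/
def wordTail (W : X → Matrix (Fin d) (Fin d) ℂ) (σ : Matrix (Fin d) (Fin d) ℂ) (xs : Fin n → X)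
    (c : ℝ) : ℝ :=
  lowerTail (fun k => jointP (W (xs k)) σ) (fun k => logRatio (W (xs k)) σ) c

lemma wordTail_mono (hW : ∀ x, IsDensity (W x)) (xs : Fin n → X) {b c : ℝ} (h : b ≤ c) :
    wordTail W σ xs b ≤ wordTail W σ xs c :=
  lowerTail_mono (fun k => jointP_nonneg (hW (xs k)).1) h

end WordTail

section Words

open Set Topology

variable {X : Type} [Fintype X] {d n : ℕ} {W : X → Matrix (Fin d) (Fin d) ℂ} {P : X → ℝ}
  {σ : Matrix (Fin d) (Fin d) ℂ}

lemma sum_apply_eq_empDist (xs : Fin n → X) (g : X → ℝ) :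
    ∑ k, g (xs k) = n * ∑ x, empDist xs x * g x := by
  classical
  rcases Nat.eq_zero_or_pos n with rfl | hn
  · simp
  have hn' : (n : ℝ) ≠ 0 := by positivity
  rw [Finset.mul_sum, ← Finset.sum_fiberwise Finset.univ xs]
  refine Finset.sum_congr rfl fun x _ => ?_
  rw [Finset.sum_congr rfl (g := fun _ => g x) fun k hk => by rw [(Finset.mem_filter.1 hk).2],
    Finset.sum_const, nsmul_eq_mul, empDist, ← mul_assoc, mul_div_cancel₀ _ hn']

lemma isProbDist_empDist (hn : 0 < n) (xs : Fin n → X) : IsProbDist (empDist xs) := by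
  refine ⟨fun x => by unfold empDist; positivity, ?_⟩
  have h := sum_apply_eq_empDist xs fun _ => 1
  have hn' : (n : ℝ) ≠ 0 := by positivity
  simp only [mul_one, Finset.sum_const, Finset.card_univ, Fintype.card_fin, nsmul_eq_mul] at h
  exact (mul_left_cancel₀ hn' (by rw [mul_one, ← h])).symm

lemma sum_jointP_mul_centred {ρ : Matrix (Fin d) (Fin d) ℂ} (hρ : IsDensity ρ) (hσ : IsDensity σ) :
    ∑ z, jointP ρ σ z * (logRatio ρ σ z - qD ρ σ) = 0 := by
  simp only [mul_sub]
  rw [Finset.sum_sub_distrib, ← Finset.sum_mul, sum_jointP hρ, ← qD_eq_sum hρ.1.1 hσ.1.1]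
  ring

lemma exists_abs_logRatio_sub_le (W : X → Matrix (Fin d) (Fin d) ℂ)
    (σ : Matrix (Fin d) (Fin d) ℂ) :
    ∃ B : ℝ, 0 ≤ B ∧ ∀ x z, |logRatio (W x) σ z - qD (W x) σ| ≤ B := by
  refine ⟨∑ x, ∑ z, |logRatio (W x) σ z - qD (W x) σ|,
    Finset.sum_nonneg fun x _ => Finset.sum_nonneg fun z _ => abs_nonneg _, fun x z => ?_⟩
  refine le_trans (Finset.single_le_sum (f := fun z => |logRatio (W x) σ z - qD (W x) σ|)
    (fun _ _ => abs_nonneg _) (Finset.mem_univ z)) ?_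
  exact Finset.single_le_sum (f := fun x => ∑ z, |logRatio (W x) σ z - qD (W x) σ|)
    (fun _ _ => Finset.sum_nonneg fun _ _ => abs_nonneg _) (Finset.mem_univ x)

lemma qV_le_sq {ρ : Matrix (Fin d) (Fin d) ℂ} (hρ : IsDensity ρ) (hσ : IsDensity σ) {B : ℝ}
    (hB : ∀ z, |logRatio ρ σ z - qD ρ σ| ≤ B) : qV ρ σ ≤ B ^ 2 := by
  rw [qV_eq_variance hρ hσ.1.1, ← one_mul (B ^ 2), ← sum_jointP hρ (σ := σ), Finset.sum_mul]
  refine Finset.sum_le_sum fun z _ => mul_le_mul_of_nonneg_left ?_ (jointP_nonneg hρ.1 z)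
  rw [← sq_abs]
  exact pow_le_pow_left₀ (abs_nonneg _) (hB z) 2

lemma wordTail_eq_centred (xs : Fin n → X) (c : ℝ) :
    wordTail W σ xs (c + n * ∑ x, empDist xs x * qD (W x) σ) =
      lowerTail (fun k => jointP (W (xs k)) σ)
        (fun k z => logRatio (W (xs k)) σ z - qD (W (xs k)) σ) c := by
  unfold wordTail
  rw [← lowerTail_sub_const _ _ (fun k => qD (W (xs k)) σ),
    sum_apply_eq_empDist xs fun x => qD (W x) σ, add_sub_cancel_right]

lemma sum_variance_eq (hW : ∀ x, IsDensity (W x)) (hσ : IsDensity σ) (xs : Fin n → X) :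
    ∑ k, ∑ z, jointP (W (xs k)) σ z * (logRatio (W (xs k)) σ z - qD (W (xs k)) σ) ^ 2 =
      n * ∑ x, empDist xs x * qV (W x) σ := by
  rw [← sum_apply_eq_empDist xs fun x => qV (W x) σ]
  exact Finset.sum_congr rfl fun k _ => (qV_eq_variance (hW _) hσ.1.1).symm

lemma sum_empDist_mul_qV_le (hn : 0 < n) (hW : ∀ x, IsDensity (W x)) (hσ : IsDensity σ) {B : ℝ}
    (hB : ∀ x z, |logRatio (W x) σ z - qD (W x) σ| ≤ B) (xs : Fin n → X) :
    ∑ x, empDist xs x * qV (W x) σ ≤ B ^ 2 := by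
  have hp := isProbDist_empDist hn xs
  rw [← one_mul (B ^ 2), ← hp.2, Finset.sum_mul]
  exact Finset.sum_le_sum fun x _ =>
    mul_le_mul_of_nonneg_left (qV_le_sq (hW x) hσ (hB x)) (hp.1 x)

lemma half_le_wordTail (hn : 0 < n) (hW : ∀ x, IsDensity (W x)) (hσ : IsDensity σ) {B η : ℝ}
    (hB : ∀ x z, |logRatio (W x) σ z - qD (W x) σ| ≤ B) (hη : 0 < η) (xs : Fin n → X)
    (h : 2 * B ^ 2 ≤ n * η ^ 2) :
    1 / 2 ≤ wordTail W σ xs (n * η + n * ∑ x, empDist xs x * qD (W x) σ) := by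
  have hn' : (0 : ℝ) < n := by positivity
  rw [wordTail_eq_centred]
  refine le_trans ?_ (one_sub_le_lowerTail (fun k => jointP_nonneg (hW (xs k)).1)
    (fun k => sum_jointP (hW (xs k))) (fun k => sum_jointP_mul_centred (hW (xs k)) hσ)
    (mul_pos hn' hη))
  rw [sum_variance_eq hW hσ]
  have h1 := sum_empDist_mul_qV_le hn hW hσ hB xs
  have h2 : n * ∑ x, empDist xs x * qV (W x) σ ≤ 1 / 2 * (n * η) ^ 2 := by
    have := mul_le_mul_of_nonneg_left h1 hn'.le
    have := mul_le_mul_of_nonneg_left h hn'.le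
    nlinarith
  have h3 := (div_le_iff₀ (by positivity : 0 < (n * η) ^ 2)).2 h2
  linarith

lemma exp_neg_le_wordTail (hn : 0 < n) (hW : ∀ x, IsDensity (W x)) (hσ : IsDensity σ) {B : ℝ}
    (hB0 : 0 ≤ B) (hB : ∀ x z, |logRatio (W x) σ z - qD (W x) σ| ≤ B) (xs : Fin n → X)
    {a δ v K : ℝ} (ha : 0 < a) (hδ : 0 < δ) (hv : 0 < v) (hK : 0 < K)
    (hvar : v ≤ ∑ x, empDist xs x * qV (W x) σ) (haB : a * (1 + 2 * δ) / v * B ≤ 1 / 2)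
    (h : 2 + 2 * K * B ^ 2 / δ ^ 2 ≤ n * a ^ 2 *
      (K - (1 + 2 * δ) ^ 2 / (2 * v) - 4 * B * (1 + 2 * δ) ^ 3 / v ^ 2 * a)) :
    Real.exp (-(n * a ^ 2 * K)) ≤
      wordTail W σ xs (-(n * (a * (1 + δ))) + n * ∑ x, empDist xs x * qD (W x) σ) := by
  have hn' : (0 : ℝ) < n := by positivity
  set w := ∑ x, empDist xs x * qV (W x) σ with hw
  have hw0 : 0 < w := hv.trans_le hvar
  have hwB : w ≤ B ^ 2 := sum_empDist_mul_qV_le hn hW hσ hB xs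
  set s := a * (1 + 2 * δ) / w with hs
  have hs0 : 0 ≤ s := by positivity
  have hsv : s ≤ a * (1 + 2 * δ) / v := by
    rw [hs]
    gcongr
  have hsw : s * w = a * (1 + 2 * δ) := div_mul_cancel₀ _ hw0.ne'
  have e : -(n * (a * (1 + δ))) = -(s * (n * w)) + n * (a * δ) := by
    linear_combination (n : ℝ) * hsw
  rw [wordTail_eq_centred, e]
  refine exp_neg_le_lowerTail (fun k => jointP_nonneg (hW (xs k)).1)
    (fun k => sum_jointP (hW (xs k))) (fun k => sum_jointP_mul_centred (hW (xs k)) hσ)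
    (B := B) (fun k z => hB _ z) hs0 ((mul_le_mul_of_nonneg_right hsv hB0).trans haB)
    (by positivity) (by positivity) (sum_variance_eq hW hσ xs) ?_
  have h1 : s ^ 2 * (n * w) / 2 ≤ n * a ^ 2 * ((1 + 2 * δ) ^ 2 / (2 * v)) := by
    have : s ^ 2 * (n * w) / 2 = n * (a * (1 + 2 * δ)) / 2 * s := by
      rw [← hsw]
      ring
    rw [this]
    refine (mul_le_mul_of_nonneg_left hsv (by positivity)).trans (le_of_eq ?_)
    field_simp
  have h2 : 4 * s ^ 3 * B * (n * w) ≤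
      n * a ^ 2 * (4 * B * (1 + 2 * δ) ^ 3 / v ^ 2 * a) := by
    have : 4 * s ^ 3 * B * (n * w) = 4 * B * n * (a * (1 + 2 * δ)) * s ^ 2 := by
      rw [← hsw]
      ring
    rw [this]
    refine (mul_le_mul_of_nonneg_left (pow_le_pow_left₀ hs0 hsv 2) (by positivity)).trans
      (le_of_eq ?_)
    field_simp
  have h3 : n * a ^ 2 * K * (2 * (n * w) / (n * (a * δ)) ^ 2) ≤ 2 * K * B ^ 2 / δ ^ 2 := by
    have : n * a ^ 2 * K * (2 * (n * w) / (n * (a * δ)) ^ 2) = 2 * K * w / δ ^ 2 := by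
      field_simp
    rw [this]
    gcongr
  linarith

/-- Eventually, every word whose type lies in `U` has lower tail at level `c n` at least
`exp (-θ n)` against one of finitely many states. -/
def TailBound (W : X → Matrix (Fin d) (Fin d) ℂ) (θ c : ℕ → ℝ) (U : Set (X → ℝ)) : Prop :=
  ∃ F : Set (Matrix (Fin d) (Fin d) ℂ), F.Finite ∧
    (∀ σ ∈ F, IsDensity σ ∧ ∀ x, AbsCont (W x) σ) ∧
    ∀ᶠ n in atTop, ∀ xs : Fin n → X, empDist xs ∈ U →
      ∃ σ ∈ F, Real.exp (-θ n) ≤ wordTail W σ xs (c n)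

lemma TailBound.union {θ c : ℕ → ℝ} {U V : Set (X → ℝ)} (hU : TailBound W θ c U)
    (hV : TailBound W θ c V) : TailBound W θ c (U ∪ V) := by
  obtain ⟨F, hF, hFd, hFt⟩ := hU
  obtain ⟨G, hG, hGd, hGt⟩ := hV
  refine ⟨F ∪ G, hF.union hG, fun σ hσ => hσ.elim (hFd σ) (hGd σ), ?_⟩
  filter_upwards [hFt, hGt] with n h1 h2 xs hxs
  rcases hxs with h | h
  · obtain ⟨σ, hσ, hb⟩ := h1 xs h
    exact ⟨σ, Or.inl hσ, hb⟩
  · obtain ⟨σ, hσ, hb⟩ := h2 xs h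
    exact ⟨σ, Or.inr hσ, hb⟩

lemma TailBound.mono {θ c : ℕ → ℝ} {U V : Set (X → ℝ)} (hV : TailBound W θ c V) (h : U ⊆ V) :
    TailBound W θ c U := by
  obtain ⟨F, hF, hFd, hFt⟩ := hV
  exact ⟨F, hF, hFd, hFt.mono fun n hn xs hxs => hn xs (h hxs)⟩

variable {a : ℕ → ℝ} {δ K : ℝ}

lemma exists_tailBound_of_eq_capacity (hW : ∀ x, IsDensity (W x)) (ha : ∀ᶠ n in atTop, 0 < a n)
    (ha0 : Tendsto a atTop (𝓝 0)) (ha2 : Tendsto (fun n : ℕ => n * a n ^ 2) atTop atTop)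
    (hδ : 0 < δ) {v : ℝ} (hv : 0 < v) (hK : (1 + 2 * δ) ^ 2 / (2 * v) < K) (hP : IsProbDist P)
    (hC : mutualInfo P W = capacity W) (hPv : v < infoVar P W) :
    ∃ U ∈ 𝓝 P, TailBound W (fun n => n * a n ^ 2 * K)
      (fun n => n * (capacity W - a n * (1 + δ))) U := by
  set σ := avgState P W with hσdef
  have hσ : IsDensity σ := avgState_isDensity hW hP
  have hK0 : 0 < K := lt_of_le_of_lt (by positivity) hK
  obtain ⟨B, hB0, hB⟩ := exists_abs_logRatio_sub_le W σ
  have hU : {Q : X → ℝ | v < ∑ x, Q x * qV (W x) σ} ∈ 𝓝 P :=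
    (isOpen_lt (by fun_prop) (by fun_prop)).mem_nhds hPv
  refine ⟨_, hU, {σ}, finite_singleton σ, ?_, ?_⟩
  · rintro _ rfl
    exact ⟨hσ, absCont_of_mutualInfo_eq_capacity hW hP hC⟩
  have l1 : Tendsto (fun n => a n * (1 + 2 * δ) / v * B) atTop (𝓝 0) := by
    simpa using ((ha0.mul_const (1 + 2 * δ)).div_const v).mul_const B
  have l2 : Tendsto (fun n => K - (1 + 2 * δ) ^ 2 / (2 * v) -
      4 * B * (1 + 2 * δ) ^ 3 / v ^ 2 * a n) atTop (𝓝 (K - (1 + 2 * δ) ^ 2 / (2 * v))) := by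
    simpa using (ha0.const_mul (4 * B * (1 + 2 * δ) ^ 3 / v ^ 2)).const_sub
      (K - (1 + 2 * δ) ^ 2 / (2 * v))
  have l3 := ha2.atTop_mul_pos (sub_pos.2 hK) l2
  filter_upwards [ha, l1.eventually_le_const (by norm_num : (0 : ℝ) < 1 / 2),
    l3.eventually_ge_atTop (2 + 2 * K * B ^ 2 / δ ^ 2), eventually_gt_atTop 0]
    with n h1 h2 h3 hn xs hxs
  have hn' : (0 : ℝ) < n := by positivity
  refine ⟨σ, rfl, (exp_neg_le_wordTail hn hW hσ hB0 hB xs h1 hδ hv hK0 (le_of_lt hxs) h2 h3).trans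
    (wordTail_mono hW xs ?_)⟩
  have hp := isProbDist_empDist hn xs
  have : ∑ x, empDist xs x * qD (W x) σ ≤ capacity W := by
    rw [← one_mul (capacity W), ← hp.2, Finset.sum_mul]
    exact Finset.sum_le_sum fun x _ =>
      mul_le_mul_of_nonneg_left (qD_le_capacity hW hP hC x) (hp.1 x)
  have := mul_le_mul_of_nonneg_left this hn'.le
  linarith

lemma exists_state_of_lt_capacity (hW : ∀ x, IsDensity (W x)) (hP : IsProbDist P)
    (hC : mutualInfo P W < capacity W) :
    ∃ σ, IsDensity σ ∧ (∀ x, AbsCont (W x) σ) ∧ ∑ x, P x * qD (W x) σ < capacity W := by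
  have hX : Nonempty X := by
    by_contra h
    rw [not_nonempty_iff] at h
    simpa using hP.2
  have hu : IsProbDist fun _ : X => (Fintype.card X : ℝ)⁻¹ :=
    ⟨fun _ => by positivity, by simp⟩
  let Q : ℝ → X → ℝ := fun t y => (1 - t) * P y + t * (Fintype.card X : ℝ)⁻¹
  have hQ : MapsTo Q (Icc 0 1) (stdSimplex ℝ X) := fun t ht => isProbDist_mix hP hu ht.1 ht.2
  have hQc : Continuous Q := by
    refine continuous_pi fun y => ?_
    fun_prop
  have hcont : ContinuousOn (fun t => mutualInfo (Q t) W - (1 - t) * capacity W) (Icc 0 1) :=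
    ((continuousOn_mutualInfo hW).comp hQc.continuousOn hQ).sub (by fun_prop)
  have h0 : Q 0 = P := by
    funext y
    simp [Q]
  have hw := (hcont 0 (by simp)).mono Ioo_subset_Icc_self
  have : (𝓝[Ioo (0 : ℝ) 1] 0).NeBot := by
    rw [← mem_closure_iff_nhdsWithin_neBot, closure_Ioo zero_ne_one]
    simp
  obtain ⟨t, ht, ht1⟩ := ((hw.eventually_lt_const (u := 0) (by simp only [h0]; linarith)).and
    self_mem_nhdsWithin).exists
  have hQt := hQ (Ioo_subset_Icc_self ht1)
  have hpos : 0 < t * (Fintype.card X : ℝ)⁻¹ := mul_pos ht1.1 (by positivity)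
  have hac : ∀ x, AbsCont (W x) (avgState (Q t) W) := fun x =>
    absCont_avgState_of_pos (fun x => (hW x).1) hQt.1
      (add_pos_of_nonneg_of_pos (mul_nonneg (sub_nonneg.2 ht1.2.le) (hP.1 x)) hpos)
  refine ⟨avgState (Q t) W, avgState_isDensity hW hQt, hac, ?_⟩
  have h1 : (1 - t) * ∑ x, P x * qD (W x) (avgState (Q t) W) ≤ mutualInfo (Q t) W := by
    unfold mutualInfo
    rw [Finset.mul_sum]
    refine Finset.sum_le_sum fun x _ => ?_
    rw [← mul_assoc]
    exact mul_le_mul_of_nonneg_right (le_add_of_nonneg_right hpos.le)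
      (qD_nonneg (hW x) (avgState_isDensity hW hQt) (hac x))
  exact lt_of_mul_lt_mul_left (h1.trans_lt (sub_neg.1 ht)) (sub_nonneg.2 ht1.2.le)

lemma exists_tailBound_of_lt_capacity (hW : ∀ x, IsDensity (W x))
    (ha0 : Tendsto a atTop (𝓝 0)) (ha2 : Tendsto (fun n : ℕ => n * a n ^ 2) atTop atTop)
    (hK : 0 < K) (hP : IsProbDist P) (hC : mutualInfo P W < capacity W) :
    ∃ U ∈ 𝓝 P, TailBound W (fun n => n * a n ^ 2 * K)
      (fun n => n * (capacity W - a n * (1 + δ))) U := by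
  obtain ⟨σ, hσ, hac, hlt⟩ := exists_state_of_lt_capacity hW hP hC
  obtain ⟨B, -, hB⟩ := exists_abs_logRatio_sub_le W σ
  obtain ⟨b, hb1, hb2⟩ := exists_between hlt
  set η := (capacity W - b) / 2 with hη
  have hη0 : 0 < η := by linarith
  have hU : {Q : X → ℝ | ∑ x, Q x * qD (W x) σ < b} ∈ 𝓝 P :=
    (isOpen_lt (by fun_prop) (by fun_prop)).mem_nhds hb1
  refine ⟨_, hU, {σ}, finite_singleton σ, ?_, ?_⟩
  · rintro _ rfl
    exact ⟨hσ, hac⟩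
  have l1 : Tendsto (fun n => a n * (1 + δ)) atTop (𝓝 0) := by
    simpa using ha0.mul_const (1 + δ)
  have l2 : Tendsto (fun n : ℕ => (n : ℝ) * η ^ 2) atTop atTop :=
    tendsto_natCast_atTop_atTop.atTop_mul_const (by positivity)
  have l3 : Tendsto (fun n : ℕ => Real.exp (-(n * a n ^ 2 * K))) atTop (𝓝 0) :=
    Real.tendsto_exp_neg_atTop_nhds_zero.comp (ha2.atTop_mul_const hK)
  filter_upwards [l1.eventually_le_const hη0, l2.eventually_ge_atTop (2 * B ^ 2),
    l3.eventually_le_const (by norm_num : (0 : ℝ) < 1 / 2), eventually_gt_atTop 0]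
    with n h1 h2 h3 hn xs hxs
  have hn' : (0 : ℝ) < n := by positivity
  refine ⟨σ, rfl, h3.trans ((half_le_wordTail hn hW hσ hB hη0 xs h2).trans
    (wordTail_mono hW xs ?_))⟩
  rw [← mul_add]
  refine mul_le_mul_of_nonneg_left ?_ hn'.le
  have : ∑ x, empDist xs x * qD (W x) σ < b := hxs
  linarith

lemma tailBound_stdSimplex (hW : ∀ x, IsDensity (W x)) (ha : ∀ᶠ n in atTop, 0 < a n)
    (ha0 : Tendsto a atTop (𝓝 0)) (ha2 : Tendsto (fun n : ℕ => n * a n ^ 2) atTop atTop)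
    (hδ : 0 < δ) {v : ℝ} (hv : 0 < v) (hK : (1 + 2 * δ) ^ 2 / (2 * v) < K)
    (hvar : ∀ P, IsProbDist P → mutualInfo P W = capacity W → v < infoVar P W) :
    TailBound W (fun n => n * a n ^ 2 * K) (fun n => n * (capacity W - a n * (1 + δ)))
      (stdSimplex ℝ X) := by
  refine (isCompact_stdSimplex ℝ X).induction_on (p := TailBound W _ _) ?_
    (fun s t hst ht => ht.mono hst) (fun s t hs ht => hs.union ht) fun P hP => ?_
  · exact ⟨∅, finite_empty, by simp, by simp⟩
  rcases (mutualInfo_le_capacity hW hP).eq_or_lt with hC | hC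
  · obtain ⟨U, hU, h⟩ :=
      exists_tailBound_of_eq_capacity hW ha ha0 ha2 hδ hv hK hP hC (hvar P hP hC)
    exact ⟨U, mem_nhdsWithin_of_mem_nhds hU, h⟩
  · obtain ⟨U, hU, h⟩ := exists_tailBound_of_lt_capacity (δ := δ) hW ha0 ha2
      (lt_of_le_of_lt (by positivity) hK) hP hC
    exact ⟨U, mem_nhdsWithin_of_mem_nhds hU, h⟩

end Words

section Converse

open Set Topology

variable {X : Type} {d n : ℕ} {W : X → Matrix (Fin d) (Fin d) ℂ}

lemma code_error_ge (hW : ∀ x, IsDensity (W x)) {M : ℕ} (hM : 0 < M) (f : Fin M → Fin n → X)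
    {Pov : Fin M → Matrix (Fin n → Fin d) (Fin n → Fin d) ℂ} (hPov : ∀ m, (Pov m).PosSemidef)
    (hsum : ∑ m, Pov m = 1) (F : Finset (Matrix (Fin d) (Fin d) ℂ))
    (hF : ∀ σ ∈ F, IsDensity σ ∧ ∀ x, AbsCont (W x) σ) {ε c : ℝ}
    (h : ∀ m, ∃ σ ∈ F, ε ≤ wordTail W σ (f m) c) :
    ε / 2 - Real.exp c * F.card / M ≤
      1 / (M : ℝ) * ∑ m, (1 - reTr (Pov m * tensorSeq fun k => W (f m k))) := by
  have hM' : (0 : ℝ) < M := by positivity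
  have hcompl : ∀ m, (1 - Pov m).PosSemidef := by
    intro m
    rw [← hsum, ← Finset.add_sum_erase _ _ (Finset.mem_univ m), add_sub_cancel_left]
    exact Matrix.posSemidef_sum _ fun j _ => hPov j
  have hpt : ∀ m, ε / 2 - Real.exp c * ∑ σ ∈ F, reTr (Pov m * tensorPow σ n) ≤
      1 - reTr (Pov m * tensorSeq fun k => W (f m k)) := by
    intro m
    obtain ⟨σ, hσ, hε⟩ := h m
    have h1 := half_lowerTail_le (fun k => (hW (f m k)).1) (hF σ hσ).1.1
      (fun k => (hF σ hσ).2 (f m k)) c (hPov m) (hcompl m)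
    rw [Matrix.sub_mul, reTr_sub, Matrix.one_mul, reTr_tensorSeq fun k => hW (f m k)] at h1
    have h2 : reTr (Pov m * tensorPow σ n) ≤ ∑ σ ∈ F, reTr (Pov m * tensorPow σ n) :=
      Finset.single_le_sum (f := fun σ => reTr (Pov m * tensorPow σ n)) (fun τ hτ =>
        reTr_mul_nonneg (hPov m) (tensorSeq_posSemidef fun _ => (hF τ hτ).1.1)) hσ
    have h3 := mul_le_mul_of_nonneg_left h2 (Real.exp_pos c).le
    unfold wordTail at hε
    linarith
  have hFsum : ∑ m, ∑ σ ∈ F, reTr (Pov m * tensorPow σ n) = F.card := by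
    rw [Finset.sum_comm, Finset.sum_congr rfl (g := fun _ => (1 : ℝ)) fun σ hσ => ?_]
    · simp
    · rw [← reTr_sum, ← Finset.sum_mul, hsum, Matrix.one_mul]
      exact reTr_tensorSeq fun _ => (hF σ hσ).1
  have hs := Finset.sum_le_sum fun m (_ : m ∈ Finset.univ) => hpt m
  rw [Finset.sum_sub_distrib, ← Finset.mul_sum, hFsum, Finset.sum_const, Finset.card_univ,
    Fintype.card_fin, nsmul_eq_mul] at hs
  have := mul_le_mul_of_nonneg_left hs (by positivity : (0 : ℝ) ≤ 1 / M)
  refine le_trans (le_of_eq ?_) this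
  field_simp

variable [Fintype X]

lemma le_log_optErr {R ε : ℝ} (hε : 0 < ε) (hε1 : ε ≤ 1)
    (h : ∀ (f : Fin ⌈Real.exp (n * R)⌉₊ → Fin n → X)
      (Pov : Fin ⌈Real.exp (n * R)⌉₊ → Matrix (Fin n → Fin d) (Fin n → Fin d) ℂ),
      (∀ m, (Pov m).PosSemidef) → ∑ m, Pov m = 1 →
      ε ≤ 1 / (⌈Real.exp (n * R)⌉₊ : ℝ) *
        ∑ m, (1 - reTr (Pov m * tensorSeq fun k => W (f m k)))) :
    Real.log ε ≤ Real.log (optErr W n R) := by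
  unfold optErr
  set S := {e : ℝ | ∃ (f : Fin ⌈Real.exp (n * R)⌉₊ → Fin n → X)
    (Pov : Fin ⌈Real.exp (n * R)⌉₊ → Matrix (Fin n → Fin d) (Fin n → Fin d) ℂ),
    (∀ m, (Pov m).PosSemidef) ∧ (∑ m, Pov m) = 1 ∧
    e = (1 / (⌈Real.exp (n * R)⌉₊ : ℝ)) *
      ∑ m, (1 - reTr (Pov m * tensorSeq (fun k => W (f m k))))} with hS
  rcases S.eq_empty_or_nonempty with he | hne
  · rw [he, Real.sInf_empty, Real.log_zero]
    exact Real.log_nonpos hε.le hε1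
  · refine Real.log_le_log hε (le_csInf hne ?_)
    rintro _ ⟨f, Pov, h1, h2, rfl⟩
    exact h f Pov h1 h2

lemma eventually_le_log_optErr (hW : ∀ x, IsDensity (W x)) {a : ℕ → ℝ} {δ K : ℝ}
    (ha : ∀ᶠ n in atTop, 0 < a n) (ha0 : Tendsto a atTop (𝓝 0))
    (ha1 : Tendsto (fun n : ℕ => n * a n) atTop atTop) (hδ : 0 < δ) (hK : 0 < K)
    (h : TailBound W (fun n => n * a n ^ 2 * K) (fun n => n * (capacity W - a n * (1 + δ)))
      (stdSimplex ℝ X)) :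
    ∀ᶠ n : ℕ in atTop, -Real.log 4 - n * a n ^ 2 * K ≤
      Real.log (optErr W n (capacity W - a n)) := by
  obtain ⟨F, hF, hFd, hFt⟩ := h
  lift F to Finset (Matrix (Fin d) (Fin d) ℂ) using hF
  have l1 : Tendsto (fun n => δ - a n * K) atTop (𝓝 δ) := by
    simpa using (ha0.mul_const K).const_sub δ
  have l2 := Real.tendsto_exp_atTop.comp (ha1.atTop_mul_pos hδ l1)
  filter_upwards [ha, hFt, l2.eventually_ge_atTop (4 * F.card), eventually_gt_atTop 0]
    with n h1 h2 h3 hn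
  have e0 : -Real.log 4 - n * a n ^ 2 * K = Real.log (Real.exp (-(n * a n ^ 2 * K)) / 4) := by
    rw [Real.log_div (Real.exp_pos _).ne' (by norm_num), Real.log_exp]
    ring
  have hexp1 : Real.exp (-(n * a n ^ 2 * K)) ≤ 1 := by
    rw [Real.exp_le_one_iff]
    have : 0 ≤ n * a n ^ 2 * K := by positivity
    linarith
  rw [e0]
  refine le_log_optErr (by positivity) (by linarith) fun f Pov hp hs => ?_
  have hM : 0 < ⌈Real.exp (n * (capacity W - a n))⌉₊ := Nat.ceil_pos.2 (Real.exp_pos _)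
  refine le_trans ?_ (code_error_ge hW hM f hp hs F hFd fun m =>
    h2 (f m) (isProbDist_empDist hn (f m)))
  have h4 : Real.exp (n * (capacity W - a n * (1 + δ))) * F.card /
      ⌈Real.exp (n * (capacity W - a n))⌉₊ ≤ Real.exp (-(n * a n ^ 2 * K)) / 4 := by
    rw [div_le_iff₀ (by positivity)]
    have h5 := Nat.le_ceil (Real.exp (n * (capacity W - a n)))
    have h6 := mul_le_mul_of_nonneg_left h5
      (by positivity : 0 ≤ Real.exp (-(n * a n ^ 2 * K)) / 4)
    refine le_trans ?_ h6
    simp only [Function.comp_apply] at h3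
    have h7 := mul_le_mul_of_nonneg_left h3
      (Real.exp_pos (n * (capacity W - a n * (1 + δ)))).le
    rw [← Real.exp_add] at h7
    have h8 : Real.exp (-(n * a n ^ 2 * K)) * Real.exp (n * (capacity W - a n)) =
        Real.exp (n * (capacity W - a n * (1 + δ)) + n * a n * (δ - a n * K)) := by
      rw [← Real.exp_add]
      congr 1
      ring
    linarith
  linarith

lemma eventually_neg_le_rate (hW : ∀ x, IsDensity (W x)) {a : ℕ → ℝ} {v K : ℝ} (hv : 0 < v)
    (hvar : ∀ P, IsProbDist P → mutualInfo P W = capacity W → v ≤ infoVar P W)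
    (ha0 : Tendsto a atTop (𝓝 0)) (ha1 : Tendsto (fun n : ℕ => a n * √n) atTop atTop)
    (hK : 1 / (2 * v) < K) :
    ∀ᶠ n : ℕ in atTop,
      -K ≤ 1 / ((n : ℝ) * a n ^ 2) * Real.log (optErr W n (capacity W - a n)) := by
  have ha : ∀ᶠ n in atTop, 0 < a n := by
    filter_upwards [ha1.eventually_gt_atTop 0] with n hn
    exact pos_of_mul_pos_left hn (Real.sqrt_nonneg _)
  have hna : Tendsto (fun n : ℕ => n * a n) atTop atTop := by
    have := ha1.atTop_mul_atTop₀
      (Real.tendsto_sqrt_atTop.comp (tendsto_natCast_atTop_atTop (R := ℝ)))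
    refine this.congr fun n => ?_
    simp only [Function.comp_apply]
    rw [mul_assoc, Real.mul_self_sqrt (Nat.cast_nonneg n), mul_comm]
  have hna2 : Tendsto (fun n : ℕ => n * a n ^ 2) atTop atTop := by
    refine (ha1.atTop_mul_atTop₀ ha1).congr fun n => ?_
    linear_combination a n ^ 2 * Real.mul_self_sqrt (Nat.cast_nonneg n)
  obtain ⟨L, hL1, hL2⟩ := exists_between hK
  obtain ⟨δ, hδ, hδ0⟩ : ∃ δ : ℝ, (1 + 2 * δ) ^ 3 / (2 * v) < L ∧ 0 < δ := by
    have hc : ContinuousAt (fun δ : ℝ => (1 + 2 * δ) ^ 3 / (2 * v)) 0 := by fun_prop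
    exact (((hc.eventually_lt_const (by simpa using hL1)).filter_mono nhdsWithin_le_nhds).and
      (self_mem_nhdsWithin (a := (0 : ℝ)) (s := Ioi 0))).exists
  have hL : 0 < L := lt_trans (by positivity) hL1
  have hden : 0 < 1 + 2 * δ := by positivity
  have hvlt : v / (1 + 2 * δ) < v := div_lt_self hv (by linarith)
  have htail := tailBound_stdSimplex (v := v / (1 + 2 * δ)) (K := L) hW ha ha0 hna2 hδ0
    (by positivity) (by
      refine lt_of_eq_of_lt ?_ hδ
      field_simp) fun P hP hC => hvlt.trans_le (hvar P hP hC)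
  filter_upwards [eventually_le_log_optErr hW ha ha0 hna hδ0 hL htail,
    (hna2.const_mul_atTop (sub_pos.2 hL2)).eventually_ge_atTop (Real.log 4),
    hna2.eventually_gt_atTop 0] with n h1 h2 h3
  rw [one_div, inv_mul_eq_div, le_div_iff₀ h3]
  linarith

end Converse

/-- **Moderate deviation converse for classical-quantum channel coding.** -/
theorem moderate_deviation_converse_cq
    {X : Type} [Fintype X] {d : ℕ}
    (W : X → Matrix (Fin d) (Fin d) ℂ) (hW : ∀ x, IsDensity (W x))
    (hV : 0 < Vmin W)
    (a : ℕ → ℝ)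
    (ha0 : Filter.Tendsto a Filter.atTop (nhds 0))
    (ha1 : Filter.Tendsto (fun n : ℕ => a n * Real.sqrt n) Filter.atTop Filter.atTop) :
    Filter.liminf
      (fun n : ℕ => (1 / ((n : ℝ) * (a n) ^ 2)) *
        Real.log (optErr W n (capacity W - a n))) Filter.atTop ≥
      -1 / (2 * Vmin W) := by
  have hvar : ∀ P, IsProbDist P → mutualInfo P W = capacity W → Vmin W ≤ infoVar P W := by
    intro P hP hC
    refine csInf_le ?_ ⟨P, hP, hC, rfl⟩
    by_contra hbdd
    exact hV.ne' (Real.sInf_of_not_bddBelow hbdd)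
  rw [ge_iff_le, liminf_eq]
  set S := {c : ℝ | ∀ᶠ n : ℕ in atTop,
    c ≤ 1 / ((n : ℝ) * a n ^ 2) * Real.log (optErr W n (capacity W - a n))} with hS
  by_cases hbdd : BddAbove S
  · rw [neg_div, neg_le]
    refine le_of_forall_gt_imp_ge_of_dense fun K hK => ?_
    rw [neg_le]
    exact le_csSup hbdd (eventually_neg_le_rate hW hV hvar ha0 ha1 hK)
  · rw [Real.sSup_of_not_bddAbove hbdd, neg_div]
    exact neg_nonpos.2 (by positivity)

end MDQ
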